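/- arXiv:2005.12571 — 2 statements merged into one kernel-verified Lean document; each statement's English description precedes it below -/
import Mathlib

section
/- Let M be the open Möbius strip and let D be an open connected subset of M which is an orientable surface. Then every simple closed curve γ contained in D disconnects D, i.e. D \ γ is not connected. -/
noncomputable section

/-- The unit 2-sphere in `ℝ³`. -/
abbrev Sphere2 : Set (EuclideanSpace ℝ (Fin 3)) := Metric.sphere 0 1

/-- The antipodal map on the 2-sphere. -/
def antipodal (x : Sphere2) : Sphere2 :=
  ⟨-x.1, by
    rw [mem_sphere_zero_iff_norm, norm_neg]
    exact mem_sphere_zero_iff_norm.mp x.2⟩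

/-- The real projective plane, as the quotient of the sphere by the antipodal map. -/
abbrev RealProjectivePlane : Type := Quot (fun x y : Sphere2 => y = antipodal x)

/-- The covering projection from the sphere to the projective plane. -/
def sphereProj : Sphere2 → RealProjectivePlane := Quot.mk _

/-- The unit circle in the plane. -/
abbrev Circle2 : Set (EuclideanSpace ℝ (Fin 2)) := Metric.sphere 0 1

/-- The open unit disk in the plane. -/
abbrev OpenDisk : Set (EuclideanSpace ℝ (Fin 2)) := Metric.ball 0 1

/-- An open annulus in the plane. -/
abbrev OpenAnnulus : Set (EuclideanSpace ℝ (Fin 2)) := {x | ‖x‖ ∈ Set.Ioo (1:ℝ) 2}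

/-- A set is a simple closed curve if it is homeomorphic to the circle. -/
def IsSimpleClosedCurve {X : Type*} [TopologicalSpace X] (C : Set X) : Prop :=
  Nonempty (C ≃ₜ Circle2)

/-- The strip `ℝ × (-1,1)`. -/
abbrev MobiusDom : Type := {p : ℝ × ℝ // p.2 ∈ Set.Ioo (-1:ℝ) 1}

/-- The generating relation `(x, y) ∼ (x + 1, -y)` for the open Möbius strip. -/
def mobiusRel (p q : MobiusDom) : Prop := q.1.1 = p.1.1 + 1 ∧ q.1.2 = -p.1.2

/-- The open Möbius strip: the quotient of `ℝ × (-1,1)` by `(x,y) ∼ (x+1,-y)`. -/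
abbrev OpenMobius : Type := Quot mobiusRel

/-- The generating relation `(x, y) ∼ (x + 2, y)` for the open cylinder. -/
def cylinderRel (p q : MobiusDom) : Prop := q.1.1 = p.1.1 + 2 ∧ q.1.2 = p.1.2

/-- The open cylinder: the quotient of `ℝ × (-1,1)` by `(x,y) ∼ (x+2,y)`. -/
abbrev OpenCylinder : Type := Quot cylinderRel

/-- The orientation double covering of the open Möbius strip by the open cylinder. -/
def mobiusCover : OpenCylinder → OpenMobius :=
  Quot.lift (fun p => Quot.mk mobiusRel p) (by
    rintro p q ⟨h1, h2⟩
    have hmid : (-p.1.2) ∈ Set.Ioo (-1:ℝ) 1 := by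
      obtain ⟨ha, hb⟩ := p.2; constructor <;> linarith
    have s1 : Quot.mk mobiusRel p = Quot.mk mobiusRel ⟨(p.1.1 + 1, -p.1.2), hmid⟩ :=
      Quot.sound ⟨rfl, rfl⟩
    have s2 : Quot.mk mobiusRel ⟨(p.1.1 + 1, -p.1.2), hmid⟩ = Quot.mk mobiusRel q := by
      apply Quot.sound
      constructor
      · simpa [h1] using by ring
      · simp [h2]
    exact s1.trans s2)

/-- The nontrivial deck transformation of the covering `mobiusCover`,
induced by `(x, y) ↦ (x + 1, -y)`. -/
def mobiusDeck : OpenCylinder → OpenCylinder :=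
  Quot.lift
    (fun p => Quot.mk cylinderRel
      ⟨(p.1.1 + 1, -p.1.2), by obtain ⟨ha, hb⟩ := p.2; constructor <;> dsimp <;> linarith⟩)
    (by
      rintro p q ⟨h1, h2⟩
      apply Quot.sound
      constructor
      · simpa [h1] using by ring
      · simp [h2])

/-- A 2-manifold (an open subset of a surface) is *orientable* if it contains no
homeomorphic copy of the open Möbius strip. -/
def Orientable (X : Type*) [TopologicalSpace X] : Prop :=
  ¬ ∃ A : Set X, Nonempty (A ≃ₜ OpenMobius)

end

/-- Two continuous logarithms of the same function on a preconnected set that agree at one point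
agree everywhere. -/
theorem eqOn_of_exp_eqOn {X : Type*} [TopologicalSpace X] {s : Set X} (hs : IsPreconnected s)
    {f g : X → ℂ} (hf : ContinuousOn f s) (hg : ContinuousOn g s)
    (h : ∀ x ∈ s, Complex.exp (f x) = Complex.exp (g x)) {a : X} (ha : a ∈ s) (hfg : f a = g a) :
    Set.EqOn f g s :=
  Complex.isCoveringMap_exp.eqOn_of_comp_eqOn hs hf hg
    (fun x hx => Subtype.ext (h x hx)) ha hfg

/-- If `a` is a path from `p` to `q`, the function `(z - p) / (z - q)` has a continuous logarithm
off the path. -/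
theorem exists_log_of_path (a : C(unitInterval, ℂ)) :
    ∃ L : ℂ → ℂ, ContinuousOn L (Set.range a)ᶜ ∧
      ∀ z ∉ Set.range a, Complex.exp (L z) = (z - a 1) / (z - a 0) := by
  have hne : ∀ (z : ((Set.range a)ᶜ : Set ℂ)) (t : unitInterval), (z : ℂ) - a t ≠ 0 :=
    fun z t h => z.2 ⟨t, (sub_eq_zero.mp h).symm⟩
  let H : C(unitInterval × ((Set.range a)ᶜ : Set ℂ), {z : ℂ // z ≠ 0}) :=
    { toFun := fun x => ⟨((x.2 : ℂ) - a x.1) / ((x.2 : ℂ) - a 0),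
        div_ne_zero (hne _ _) (hne _ _)⟩
      continuous_toFun := by
        refine Continuous.subtype_mk (Continuous.div (by fun_prop) (by fun_prop) ?_) _
        exact fun x => hne _ _ }
  have H0 : ∀ z, H (0, z) = ⟨_, Complex.exp_ne_zero ((ContinuousMap.const _ 0 :
      C(((Set.range a)ᶜ : Set ℂ), ℂ)) z)⟩ := fun z => by
    apply Subtype.ext
    simp [H, div_self (hne z 0)]
  let G := Complex.isCoveringMap_exp.liftHomotopy H (ContinuousMap.const _ 0) H0
  have hG : ∀ z, Complex.exp (G (1, z)) = ((z : ℂ) - a 1) / ((z : ℂ) - a 0) := fun z =>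
    congrArg Subtype.val
      (congrFun (Complex.isCoveringMap_exp.liftHomotopy_lifts H (ContinuousMap.const _ 0) H0)
        (1, z))
  classical
  refine ⟨fun z => if h : z ∈ (Set.range a)ᶜ then G (1, ⟨z, h⟩) else 0, ?_, fun z hz => ?_⟩
  · rw [continuousOn_iff_continuous_domRestrict]
    have : Continuous fun z : ((Set.range a)ᶜ : Set ℂ) => G (1, z) := by fun_prop
    refine this.congr fun z => ?_
    rw [Set.domRestrict_apply, dif_pos z.2]
  · have hz' : z ∈ (Set.range a)ᶜ := hz
    simp only [dif_pos hz']
    exact hG ⟨z, hz⟩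

/-- For `p ≠ q` the function `(z - q) / (z - p)` has no continuous logarithm on
`ℂ \ {p, q}`. -/
theorem not_exists_log_compl_pair {p q : ℂ} (hpq : p ≠ q) {L : ℂ → ℂ}
    (hL : ContinuousOn L {p, q}ᶜ)
    (hexp : ∀ z ∈ ({p, q}ᶜ : Set ℂ), Complex.exp (L z) = (z - q) / (z - p)) : False := by
  have hd : 0 < ‖p - q‖ := norm_pos_iff.mpr (sub_ne_zero.mpr hpq)
  set w : ℝ → ℂ := fun θ => (p - q) / 2 * Complex.exp (θ * Complex.I) with hw
  have hwn : ∀ θ, ‖w θ‖ = ‖p - q‖ / 2 := fun θ => by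
    simp [hw, Complex.norm_exp_ofReal_mul_I]
  have hmem : ∀ θ, p + w θ ∈ ({p, q}ᶜ : Set ℂ) := by
    intro θ h
    have h1 := hwn θ
    rcases h with h | h
    · have : w θ = 0 := by simpa using h
      rw [this, norm_zero] at h1
      linarith
    · have : w θ = -(p - q) := by
        have h' : p + w θ = q := h
        linear_combination h'
      rw [this, norm_neg] at h1
      linarith
  have hslit : ∀ θ : ℝ, 1 + Complex.exp (θ * Complex.I) / 2 ∈ Complex.slitPlane := by
    intro θ
    left
    have := Real.neg_one_le_cos θ
    simp only [Complex.add_re, Complex.one_re, Complex.div_ofNat_re, Complex.exp_ofReal_mul_I_re]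
    linarith
  have hwc : Continuous w := by fun_prop
  have h1 : Continuous fun θ : ℝ => L (p + w θ) :=
    hL.comp_continuous (by fun_prop) hmem
  have h2 : Continuous fun θ : ℝ => Complex.log (1 + Complex.exp (θ * Complex.I) / 2) :=
    Continuous.clog (by fun_prop) hslit
  have key := eqOn_of_exp_eqOn (isPreconnected_univ (α := ℝ))
    (f := fun θ : ℝ => L (p + w θ) + θ * Complex.I)
    (g := fun θ : ℝ => Complex.log (1 + Complex.exp (θ * Complex.I) / 2)
      + (L (p + w 0) - Complex.log (1 + 1 / 2)))
    (h1.add (by fun_prop)).continuousOn (h2.add continuous_const).continuousOn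
    (fun θ _ => ?_) (Set.mem_univ 0) (by simp)
  · have := key (Set.mem_univ (2 * Real.pi))
    have e : Complex.exp (((2 * Real.pi : ℝ) : ℂ) * Complex.I) = 1 := by
      push_cast
      exact Complex.exp_two_pi_mul_I
    have e2 : w (2 * Real.pi) = w 0 := by
      simp only [hw, e]
      simp
    simp only [e, e2] at this
    have : ((2 * Real.pi : ℝ) : ℂ) * Complex.I = 0 := by linear_combination this
    simp [Real.pi_ne_zero] at this
  · have hE := Complex.exp_ne_zero (θ * Complex.I)
    have hs := Complex.slitPlane_ne_zero (hslit θ)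
    have hpq' : p - q ≠ 0 := sub_ne_zero.mpr hpq
    have h32 : (1 + 1 / 2 : ℂ) ≠ 0 := by norm_num
    rw [Complex.exp_add, Complex.exp_add, Complex.exp_sub, Complex.exp_log hs,
      Complex.exp_log h32, hexp _ (hmem θ), hexp _ (hmem 0)]
    simp only [hw, Complex.ofReal_zero, zero_mul, Complex.exp_zero, mul_one]
    rw [show p + (p - q) / 2 * Complex.exp (θ * Complex.I) - q
        = (p - q) * (1 + Complex.exp (θ * Complex.I) / 2) by ring,
      show p + (p - q) / 2 * Complex.exp (θ * Complex.I) - p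
        = (p - q) / 2 * Complex.exp (θ * Complex.I) by ring,
      show p + (p - q) / 2 - q = (p - q) * (1 + 1 / 2) by ring,
      show p + (p - q) / 2 - p = (p - q) / 2 by ring]
    field_simp

/-- The union of two paths with the same endpoints `p ≠ q` that otherwise do not meet separates
the plane. -/
theorem not_isPreconnected_compl_range_union (a b : C(unitInterval, ℂ)) (h0 : a 0 = b 0)
    (h1 : a 1 = b 1) (hne : a 0 ≠ a 1) (hab : Set.range a ∩ Set.range b ⊆ {a 0, a 1}) :
    ¬ IsPreconnected (Set.range a ∪ Set.range b)ᶜ := by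
  intro hconn
  obtain ⟨L, hLc, hL⟩ := exists_log_of_path a
  obtain ⟨L', hLc', hL'⟩ := exists_log_of_path b
  have hAo : IsOpen (Set.range a)ᶜ := (isCompact_range a.continuous).isClosed.isOpen_compl
  have hBo : IsOpen (Set.range b)ᶜ := (isCompact_range b.continuous).isClosed.isOpen_compl
  obtain ⟨c, hc, hLL'⟩ : ∃ c : ℂ, Complex.exp c = 1 ∧
      ∀ z, z ∉ Set.range a → z ∉ Set.range b → L z = L' z + c := by
    by_cases hz : ∃ z, z ∉ Set.range a ∧ z ∉ Set.range b
    · obtain ⟨z₀, hz₀, hz₀'⟩ := hz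
      have he : Complex.exp (L z₀ - L' z₀) = 1 := by
        rw [Complex.exp_sub, hL _ hz₀, hL' _ hz₀', h0, h1, div_self]
        refine div_ne_zero (fun h => hz₀' ⟨1, ?_⟩) (fun h => hz₀' ⟨0, ?_⟩)
        · exact (sub_eq_zero.mp h).symm
        · exact (sub_eq_zero.mp h).symm
      refine ⟨_, he, fun z hz hz' => ?_⟩
      refine eqOn_of_exp_eqOn hconn (f := L) (g := fun z => L' z + (L z₀ - L' z₀))
        (hLc.mono (Set.compl_subset_compl.mpr Set.subset_union_left))
        ((hLc'.mono (Set.compl_subset_compl.mpr Set.subset_union_right)).add continuousOn_const)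
        (fun x hx => ?_)
        (a := z₀) (by simp only [Set.mem_compl_iff, Set.mem_union]; tauto) (by ring)
        (by simp only [Set.mem_compl_iff, Set.mem_union]; tauto)
      simp only [Set.mem_compl_iff, Set.mem_union, not_or] at hx
      rw [Complex.exp_add, he, mul_one, hL _ hx.1, hL' _ hx.2, h0, h1]
    · exact ⟨0, Complex.exp_zero, fun z h h' => (hz ⟨z, h, h'⟩).elim⟩
  classical
  refine not_exists_log_compl_pair hne
    (L := fun z => if z ∈ Set.range a then L' z + c else L z) ?_ ?_
  · intro z hz
    apply ContinuousAt.continuousWithinAt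
    by_cases hza : z ∈ Set.range a
    · have hzb : z ∈ (Set.range b)ᶜ := fun hzb => hz (hab ⟨hza, hzb⟩)
      refine ContinuousAt.congr ((hLc'.continuousAt (hBo.mem_nhds hzb)).add
        (continuousAt_const (y := c))) ?_
      filter_upwards [hBo.mem_nhds hzb] with y hy
      split_ifs with h
      · rfl
      · exact (hLL' y h hy).symm
    · refine ContinuousAt.congr (hLc.continuousAt (hAo.mem_nhds hza)) ?_
      filter_upwards [hAo.mem_nhds hza] with y hy
      rw [if_neg hy]
  · intro z hz
    split_ifs with h
    · have hzb : z ∉ Set.range b := fun hzb => hz (hab ⟨h, hzb⟩)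
      rw [Complex.exp_add, hc, mul_one, hL' _ hzb, h0, h1]
    · exact hL _ h

/-- The point of the unit circle with angle `θ`. -/
noncomputable def circlePoint (θ : ℝ) : Circle2 :=
  ⟨!₂[Real.cos θ, Real.sin θ], by
    rw [mem_sphere_zero_iff_norm, EuclideanSpace.norm_eq]
    simp⟩

theorem continuous_circlePoint : Continuous circlePoint := by
  refine Continuous.subtype_mk ?_ _
  refine (PiLp.continuous_toLp 2 _).comp (continuous_pi fun i => ?_)
  fin_cases i
  · exact Real.continuous_cos
  · exact Real.continuous_sin

theorem circlePoint_eq_iff {θ θ' : ℝ} :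
    circlePoint θ = circlePoint θ' ↔ Real.cos θ = Real.cos θ' ∧ Real.sin θ = Real.sin θ' := by
  constructor
  · intro h
    have h' := congrArg Subtype.val h
    exact ⟨congrArg (fun v => v 0) h', congrArg (fun v => v 1) h'⟩
  · rintro ⟨h1, h2⟩
    apply Subtype.ext
    simp only [circlePoint, h1, h2]

theorem exists_circlePoint_eq (x : Circle2) :
    ∃ t ∈ unitInterval, circlePoint (Real.pi * t) = x ∨ circlePoint (-(Real.pi * t)) = x := by
  have hx : (x.1 0) ^ 2 + (x.1 1) ^ 2 = 1 := by
    have := mem_sphere_zero_iff_norm.mp x.2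
    rw [EuclideanSpace.norm_eq, Real.sqrt_eq_one] at this
    simpa [Fin.sum_univ_two] using this
  have hpi := Real.pi_pos
  have hcos : Real.cos (Real.arccos (x.1 0)) = x.1 0 :=
    Real.cos_arccos (by nlinarith [sq_nonneg (x.1 1)]) (by nlinarith [sq_nonneg (x.1 1)])
  have hsin : Real.sin (Real.arccos (x.1 0)) = |x.1 1| := by
    rw [Real.sin_arccos, show 1 - x.1 0 ^ 2 = x.1 1 ^ 2 by linarith, Real.sqrt_sq_eq_abs]
  have hmul : Real.pi * (Real.arccos (x.1 0) / Real.pi) = Real.arccos (x.1 0) := by field_simp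
  refine ⟨Real.arccos (x.1 0) / Real.pi, ⟨div_nonneg (Real.arccos_nonneg _) hpi.le,
    (div_le_one hpi).mpr (Real.arccos_le_pi _)⟩, ?_⟩
  rw [hmul]
  rcases le_total 0 (x.1 1) with h | h
  · left
    apply Subtype.ext
    ext i
    fin_cases i
    · simpa [circlePoint] using hcos
    · simpa [circlePoint, abs_of_nonneg h] using hsin
  · right
    apply Subtype.ext
    ext i
    fin_cases i
    · simpa [circlePoint] using hcos
    · rw [abs_of_nonpos h] at hsin
      simp [circlePoint, hsin]

/-- A simple closed curve separates the plane. -/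
theorem not_isPreconnected_compl_range {c : Circle2 → ℂ} (hc : Continuous c)
    (hinj : Function.Injective c) : ¬ IsPreconnected (Set.range c)ᶜ := by
  let a : C(unitInterval, ℂ) := ⟨fun t => c (circlePoint (Real.pi * t)),
    hc.comp (continuous_circlePoint.comp (by fun_prop))⟩
  let b : C(unitInterval, ℂ) := ⟨fun t => c (circlePoint (-(Real.pi * t))),
    hc.comp (continuous_circlePoint.comp (by fun_prop))⟩
  have hunion : Set.range c = Set.range a ∪ Set.range b := by
    apply Set.Subset.antisymm
    · rintro _ ⟨x, rfl⟩
      obtain ⟨t, ht, h | h⟩ := exists_circlePoint_eq x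
      · exact Or.inl ⟨⟨t, ht⟩, congrArg c h⟩
      · exact Or.inr ⟨⟨t, ht⟩, congrArg c h⟩
    · rintro _ (⟨t, rfl⟩ | ⟨t, rfl⟩)
      · exact ⟨_, rfl⟩
      · exact ⟨_, rfl⟩
  rw [hunion]
  refine not_isPreconnected_compl_range_union a b ?_ ?_ ?_ ?_
  · simp [a, b]
  · simp only [a, b, ContinuousMap.coe_mk]
    congr 1
    rw [circlePoint_eq_iff]
    simp
  · simp only [a, ContinuousMap.coe_mk, hinj.ne_iff, ne_eq, circlePoint_eq_iff]
    norm_num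
  · rintro _ ⟨⟨t, rfl⟩, ⟨t', h⟩⟩
    have h := circlePoint_eq_iff.mp (hinj h)
    rw [Real.cos_neg, Real.sin_neg] at h
    have hpi := Real.pi_pos
    have ht := t.2
    have ht' := t'.2
    have s1 : 0 ≤ Real.sin (Real.pi * t) :=
      Real.sin_nonneg_of_nonneg_of_le_pi (by nlinarith [ht.1]) (by nlinarith [ht.2])
    have s2 : 0 ≤ Real.sin (Real.pi * t') :=
      Real.sin_nonneg_of_nonneg_of_le_pi (by nlinarith [ht'.1]) (by nlinarith [ht'.2])
    have s3 : Real.sin (Real.pi * t) = 0 := by linarith [h.2]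
    rcases eq_or_lt_of_le ht.1 with h0 | h0
    · left
      exact congrArg a (Subtype.ext h0.symm)
    · rcases eq_or_lt_of_le ht.2 with h1 | h1
      · right
        exact congrArg a (Subtype.ext h1)
      · exact absurd s3 (Real.sin_pos_of_pos_of_lt_pi (by positivity) (by nlinarith)).ne'

/-- A simple closed curve contained in an open subset of the plane separates it. -/
theorem not_isPreconnected_diff_range {c : Circle2 → ℂ} (hc : Continuous c)
    (hinj : Function.Injective c) {D : Set ℂ} (hD : IsOpen D) (hcD : Set.range c ⊆ D) :
    ¬ IsPreconnected (D \ Set.range c) := by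
  intro h
  have hcl : IsClosed (Set.range c) := (isCompact_range hc).isClosed
  refine not_isPreconnected_compl_range hc hinj ?_
  have main : ∀ U V : Set ℂ, IsOpen U → IsOpen V → (Set.range c)ᶜ ⊆ U ∪ V →
      (Set.range c)ᶜ ∩ (U ∩ V) = ∅ → D \ Set.range c ⊆ U → (Set.range c)ᶜ ⊆ U := by
    intro U V hU hV hUV hdisj hDU z hz
    by_contra hzU
    have hW : IsOpen (V ∩ (Set.range c)ᶜ) := hV.inter hcl.isOpen_compl
    have hWc : IsOpen (V ∩ (Set.range c)ᶜ)ᶜ := by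
      have : (V ∩ (Set.range c)ᶜ)ᶜ = D ∪ (U ∩ (Set.range c)ᶜ) := by
        apply Set.Subset.antisymm
        · intro x hx
          by_cases hxc : x ∈ Set.range c
          · exact Or.inl (hcD hxc)
          · rcases hUV hxc with hxU | hxV
            · exact Or.inr ⟨hxU, hxc⟩
            · exact (hx ⟨hxV, hxc⟩).elim
        · rintro x (hx | hx) ⟨hxV, hxc⟩
          · exact Set.notMem_empty x (hdisj ▸ ⟨hxc, hDU ⟨hx, hxc⟩, hxV⟩)
          · exact Set.notMem_empty x (hdisj ▸ ⟨hxc, hx.1, hxV⟩)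
      rw [this]
      exact hD.union (hU.inter hcl.isOpen_compl)
    have hzV : z ∈ V := (hUV hz).resolve_left hzU
    have hun : V ∩ (Set.range c)ᶜ = Set.univ :=
      IsClopen.eq_univ ⟨isOpen_compl_iff.mp hWc, hW⟩ ⟨z, hzV, hz⟩
    have : c (circlePoint 0) ∈ V ∩ (Set.range c)ᶜ := hun ▸ Set.mem_univ _
    exact this.2 ⟨_, rfl⟩
  rw [isPreconnected_iff_subset_of_disjoint]
  intro U V hU hV hUV hdisj
  rcases isPreconnected_iff_subset_of_disjoint.mp h U V hU hV
    ((fun x hx => hUV hx.2))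
    (Set.subset_eq_empty (Set.inter_subset_inter_left _ fun x hx => hx.2) hdisj) with h' | h'
  · exact Or.inl (main U V hU hV hUV hdisj h')
  · exact Or.inr (main V U hV hU (by rwa [Set.union_comm]) (by rwa [Set.inter_comm V U]) h')

/-- The `k`-th power of the glide reflection `(x, y) ↦ (x + N, -y)`. -/
def glide {R : Type*} [CommRing R] (N : R) (k : ℤ) (z : R × R) : R × R :=
  (z.1 + k * N, ((k.negOnePow : ℤ) : R) * z.2)

section Glide

variable {R : Type*} [CommRing R] (N : R)

theorem glide_zero (z : R × R) : glide N 0 z = z := by simp [glide]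

theorem glide_glide (k l : ℤ) (z : R × R) : glide N k (glide N l z) = glide N (k + l) z := by
  simp only [glide, Int.negOnePow_add, Units.val_mul]
  ext
  · push_cast; ring
  · push_cast; ring

theorem glide_neg_glide (k : ℤ) (z : R × R) : glide N (-k) (glide N k z) = z := by
  rw [glide_glide, neg_add_cancel, glide_zero]

theorem glide_glide_neg (k : ℤ) (z : R × R) : glide N k (glide N (-k) z) = z := by
  rw [glide_glide, add_neg_cancel, glide_zero]

theorem glide_of_even {k : ℤ} (hk : Even k) (z : R × R) : glide N k z = (z.1 + k * N, z.2) := by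
  simp [glide, Int.negOnePow_even k hk]

theorem glide_of_odd {k : ℤ} (hk : Odd k) (z : R × R) : glide N k z = (z.1 + k * N, -z.2) := by
  simp [glide, Int.negOnePow_odd k hk]

theorem glide_injective (k : ℤ) : Function.Injective (glide N k) :=
  Function.LeftInverse.injective (glide_neg_glide N k)

end Glide

theorem continuous_glide (N : ℝ) (k : ℤ) : Continuous (glide N k) := by
  unfold glide
  fun_prop

theorem glide_snd_mem {N : ℝ} {k : ℤ} {z : ℝ × ℝ} (hz : z.2 ∈ Set.Ioo (-1 : ℝ) 1) :
    (glide N k z).2 ∈ Set.Ioo (-1 : ℝ) 1 := by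
  rcases Int.even_or_odd k with hk | hk
  · rwa [glide_of_even N hk]
  · rw [glide_of_odd N hk]
    constructor <;> dsimp only <;> linarith [hz.1, hz.2]

theorem mobius_mk_eq_iff {p q : MobiusDom} :
    Quot.mk mobiusRel p = Quot.mk mobiusRel q ↔ ∃ k : ℤ, q.1 = glide 1 k p.1 := by
  constructor
  · intro h
    have h := Quot.eqvGen_exact h
    clear * - h
    induction h with
    | rel x y h =>
      refine ⟨1, ?_⟩
      rw [glide_of_odd _ odd_one]
      ext
      · simpa using h.1
      · exact h.2
    | refl x => exact ⟨0, (glide_zero _ _).symm⟩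
    | symm x y h ih =>
      obtain ⟨k, hk⟩ := ih
      exact ⟨-k, by rw [hk, glide_neg_glide]⟩
    | trans x y z h h' ih ih' =>
      obtain ⟨k, hk⟩ := ih
      obtain ⟨l, hl⟩ := ih'
      exact ⟨l + k, by rw [hl, hk, glide_glide]⟩
  · rintro ⟨k, hk⟩
    have step : ∀ p q : MobiusDom, q.1 = glide 1 1 p.1 →
        Quot.mk mobiusRel p = Quot.mk mobiusRel q := by
      intro p q h
      rw [glide_of_odd _ odd_one] at h
      exact Quot.sound ⟨by simp [h], by simp [h]⟩
    induction k using Int.induction_on generalizing q with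
    | zero => rw [show p = q from Subtype.ext (by rw [hk, glide_zero])]
    | succ i ih =>
      rw [ih (q := ⟨glide 1 i p.1, glide_snd_mem p.2⟩) rfl]
      exact step _ _ (by rw [hk, glide_glide, add_comm])
    | pred i ih =>
      rw [ih (q := ⟨glide 1 (-i) p.1, glide_snd_mem p.2⟩) rfl]
      refine (step _ _ ?_).symm
      rw [hk, glide_glide, add_sub_cancel]

theorem isOpenMap_mobius_mk : IsOpenMap (Quot.mk mobiusRel) := by
  intro V hV
  rw [← isQuotientMap_quot_mk.isOpen_preimage]
  have : Quot.mk mobiusRel ⁻¹' (Quot.mk mobiusRel '' V) =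
      ⋃ k : ℤ, (fun z : MobiusDom => (⟨glide 1 k z.1, glide_snd_mem z.2⟩ : MobiusDom)) ⁻¹' V := by
    ext z
    simp only [Set.mem_preimage, Set.mem_image, Set.mem_iUnion]
    constructor
    · rintro ⟨w, hw, h⟩
      obtain ⟨k, hk⟩ := mobius_mk_eq_iff.mp h.symm
      refine ⟨k, ?_⟩
      convert hw
      exact hk.symm
    · rintro ⟨k, hk⟩
      exact ⟨_, hk, (mobius_mk_eq_iff.mpr ⟨k, rfl⟩).symm⟩
  rw [this]
  exact isOpen_iUnion fun k => hV.preimage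
    (((continuous_glide 1 k).comp continuous_subtype_val).subtype_mk _)

theorem t2Space_openMobius : T2Space OpenMobius := by
  let φ : MobiusDom → ℂ × ℂ := fun z =>
    (Complex.exp (2 * Real.pi * z.1.1 * Complex.I),
      z.1.2 * Complex.exp (Real.pi * z.1.1 * Complex.I))
  have hφ : ∀ p q, mobiusRel p q → φ p = φ q := by
    rintro p q ⟨h1, h2⟩
    simp only [φ, h1, h2]
    push_cast
    ext1
    · rw [show 2 * (Real.pi : ℂ) * (p.1.1 + 1) * Complex.I
        = 2 * Real.pi * p.1.1 * Complex.I + 2 * Real.pi * Complex.I by ring, Complex.exp_add,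
        Complex.exp_two_pi_mul_I, mul_one]
    · rw [show (Real.pi : ℂ) * (p.1.1 + 1) * Complex.I
        = Real.pi * p.1.1 * Complex.I + Real.pi * Complex.I by ring, Complex.exp_add,
        Complex.exp_pi_mul_I]
      ring
  have hinj : Function.Injective (Quot.lift φ hφ) := by
    rintro ⟨p⟩ ⟨q⟩ h
    have h1 : Complex.exp (2 * Real.pi * p.1.1 * Complex.I)
      = Complex.exp (2 * Real.pi * q.1.1 * Complex.I) := congrArg Prod.fst h
    have h2 : p.1.2 * Complex.exp (Real.pi * p.1.1 * Complex.I)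
      = q.1.2 * Complex.exp (Real.pi * q.1.1 * Complex.I) := congrArg Prod.snd h
    obtain ⟨n, hn⟩ := Complex.exp_eq_exp_iff_exists_int.mp h1
    have hpi : (2 * (Real.pi : ℂ) * Complex.I) ≠ 0 := Complex.two_pi_I_ne_zero
    have hx : (p.1.1 : ℂ) = q.1.1 + n := by
      apply mul_left_cancel₀ hpi
      linear_combination hn
    have hx' : p.1.1 = q.1.1 + n := by exact_mod_cast hx
    refine (mobius_mk_eq_iff.mpr ⟨n, ?_⟩).symm
    have hE : Complex.exp (Real.pi * q.1.1 * Complex.I) ≠ 0 := Complex.exp_ne_zero _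
    rw [hx, show (Real.pi : ℂ) * (q.1.1 + n) * Complex.I
        = Real.pi * q.1.1 * Complex.I + n * (Real.pi * Complex.I) by ring, Complex.exp_add,
        Complex.exp_int_mul, Complex.exp_pi_mul_I] at h2
    rcases Int.even_or_odd n with hn | hn
    · rw [hn.neg_one_zpow, mul_one] at h2
      rw [glide_of_even _ hn]
      ext
      · simpa using hx'
      · exact_mod_cast mul_right_cancel₀ hE h2
    · rw [hn.neg_one_zpow] at h2
      rw [glide_of_odd _ hn]
      ext
      · simpa using hx'
      · have : (p.1.2 : ℂ) = -q.1.2 := by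
          apply mul_right_cancel₀ hE
          linear_combination -h2
        exact_mod_cast this
  have hcont : Continuous (Quot.lift φ hφ) :=
    continuous_quot_lift _ (by simp only [φ]; fun_prop)
  exact T2Space.of_injective_continuous hinj hcont

/-- The Möbius strip shrinks into a compact part of itself. -/
theorem exists_isEmbedding_into_isCompact :
    ∃ (B : Set OpenMobius) (σ : OpenMobius → OpenMobius), IsCompact B ∧
      Topology.IsEmbedding σ ∧ ∀ z, σ z ∈ B := by
  let h : MobiusDom → MobiusDom := fun z =>
    ⟨(z.1.1, z.1.2 / 2), by constructor <;> dsimp only <;> linarith [z.2.1, z.2.2]⟩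
  have hc : Continuous h := Continuous.subtype_mk (by fun_prop) _
  have hrel : ∀ p q, mobiusRel p q → mobiusRel (h p) (h q) := by
    rintro p q ⟨h1, h2⟩
    exact ⟨h1, by simp only [h, h2]; ring⟩
  let σ : OpenMobius → OpenMobius := Quot.map h hrel
  have hσc : Continuous σ := continuous_quot_lift _ (continuous_quot_mk.comp hc)
  have hσinj : Function.Injective σ := by
    rintro ⟨p⟩ ⟨q⟩ hpq
    obtain ⟨k, hk⟩ := mobius_mk_eq_iff.mp hpq
    refine mobius_mk_eq_iff.mpr ⟨k, ?_⟩
    have h1 : (h q).1.1 = (glide 1 k (h p).1).1 := congrArg Prod.fst hk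
    have h2 : (h q).1.2 = (glide 1 k (h p).1).2 := congrArg Prod.snd hk
    ext
    · exact h1
    · simp only [glide, h] at h2 ⊢
      linarith
  have hho : IsOpenMap h := by
    have hval : Topology.IsOpenEmbedding (Subtype.val : MobiusDom → ℝ × ℝ) :=
      (isOpen_Ioo.preimage continuous_snd).isOpenEmbedding_subtypeVal
    rw [hval.isOpenMap_iff]
    have e : (Subtype.val ∘ h : MobiusDom → ℝ × ℝ)
        = (Prod.map id (fun y : ℝ => y / 2)) ∘ Subtype.val := rfl
    rw [e]
    refine IsOpenMap.comp ?_ hval.isOpenMap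
    have hdiv : IsOpenMap fun y : ℝ => y / 2 := by
      simpa [div_eq_mul_inv] using
        (Homeomorph.mulRight₀ (2⁻¹ : ℝ) (inv_ne_zero two_ne_zero)).isOpenMap
    exact IsOpenMap.id.prodMap hdiv
  have hσo : IsOpenMap σ := by
    intro V hV
    have : σ '' V = Quot.mk mobiusRel '' (h '' (Quot.mk mobiusRel ⁻¹' V)) := by
      ext m
      constructor
      · rintro ⟨⟨z⟩, hz, rfl⟩
        exact ⟨h z, ⟨z, hz, rfl⟩, rfl⟩
      · rintro ⟨_, ⟨z, hz, rfl⟩, rfl⟩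
        exact ⟨_, hz, rfl⟩
    rw [this]
    exact isOpenMap_mobius_mk _ (hho _ (hV.preimage continuous_quot_mk))
  let K : Set MobiusDom := {z | z.1 ∈ Set.Icc (0 : ℝ) 1 ×ˢ Set.Icc (-(1 / 2) : ℝ) (1 / 2)}
  have hK : IsCompact K := by
    have : K = Subtype.val ⁻¹' (Set.Icc (0 : ℝ) 1 ×ˢ Set.Icc (-(1 / 2) : ℝ) (1 / 2)) := rfl
    rw [this]
    refine Topology.IsInducing.subtypeVal.isCompact_preimage' ?_ ?_
    · exact isCompact_Icc.prod isCompact_Icc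
    · rintro z ⟨_, hz⟩
      exact ⟨⟨z, by constructor <;> linarith [hz.1, hz.2]⟩, rfl⟩
  refine ⟨Quot.mk mobiusRel '' K, σ, hK.image continuous_quot_mk,
    (Topology.IsOpenEmbedding.of_continuous_injective_isOpenMap hσc hσinj hσo).isEmbedding, ?_⟩
  rintro ⟨z⟩
  refine ⟨⟨glide 1 (-⌊z.1.1⌋) (h z).1, glide_snd_mem (h z).2⟩, ?_,
    (mobius_mk_eq_iff.mpr ⟨_, rfl⟩).symm⟩
  have hz := z.2
  refine ⟨?_, ?_⟩
  · simp only [glide, h, Set.mem_Icc]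
    push_cast
    constructor <;> linarith [Int.floor_le z.1.1, Int.lt_floor_add_one z.1.1]
  · rcases Int.even_or_odd (-⌊z.1.1⌋) with hk | hk
    · simp only [glide_of_even _ hk, h]
      constructor <;> linarith [hz.1, hz.2]
    · simp only [glide_of_odd _ hk, h]
      constructor <;> linarith [hz.1, hz.2]

/-- A continuous injective map from the Möbius strip into `D` shows that `D` is not orientable. -/
theorem not_orientable_of_injective {D : Set OpenMobius} {F : OpenMobius → OpenMobius}
    (hF : Continuous F) (hinj : Function.Injective F) (hD : ∀ z, F z ∈ D) : ¬ Orientable D := by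
  have := t2Space_openMobius
  obtain ⟨B, σ, hB, hσ, hσB⟩ := exists_isEmbedding_into_isCompact
  have : CompactSpace B := isCompact_iff_compactSpace.mp hB
  have h1 : Topology.IsEmbedding fun b : B => F b :=
    ((hF.comp continuous_subtype_val).isClosedEmbedding
      (hinj.comp Subtype.val_injective)).isEmbedding
  have h2 : Topology.IsEmbedding fun z => F (σ z) := h1.comp (hσ.codRestrict B hσB)
  exact fun h => h ⟨_, ⟨((h2.codRestrict D fun z => hD (σ z)).toHomeomorph).symm⟩⟩

/-- The preimage of a subset of the Möbius strip in the plane. -/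
def planePreimage (D : Set OpenMobius) : Set (ℝ × ℝ) :=
  Subtype.val '' (Quot.mk mobiusRel ⁻¹' D)

section PlanePreimage

variable {D : Set OpenMobius}

theorem val_mem_planePreimage {p : MobiusDom} :
    p.1 ∈ planePreimage D ↔ Quot.mk mobiusRel p ∈ D := by
  constructor
  · rintro ⟨q, hq, h⟩
    rwa [← Subtype.ext h]
  · exact fun h => ⟨p, h, rfl⟩

theorem isOpen_planePreimage (hD : IsOpen D) : IsOpen (planePreimage D) :=
  ((isOpen_Ioo.preimage continuous_snd).isOpenEmbedding_subtypeVal).isOpenMap _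
    (hD.preimage continuous_quot_mk)

theorem glide_mem_planePreimage {z : ℝ × ℝ} (hz : z ∈ planePreimage D) (k : ℤ) :
    glide 1 k z ∈ planePreimage D := by
  obtain ⟨p, hp, rfl⟩ := hz
  refine ⟨⟨glide 1 k p.1, glide_snd_mem p.2⟩, ?_, rfl⟩
  have : Quot.mk mobiusRel p = Quot.mk mobiusRel ⟨glide 1 k p.1, glide_snd_mem p.2⟩ :=
    mobius_mk_eq_iff.mpr ⟨k, rfl⟩
  rw [Set.mem_preimage, ← this]
  exact hp

theorem glide_mem_component {x y z : ℝ × ℝ} {k : ℤ} (hx : x ∈ planePreimage D)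
    (hy : y ∈ connectedComponentIn (planePreimage D) x)
    (hk : glide 1 k y ∈ connectedComponentIn (planePreimage D) z) :
    glide 1 k x ∈ connectedComponentIn (planePreimage D) z := by
  have h1 : IsPreconnected (glide (1 : ℝ) k '' connectedComponentIn (planePreimage D) x) :=
    isPreconnected_connectedComponentIn.image _ (continuous_glide 1 k).continuousOn
  have h2 : glide (1 : ℝ) k '' connectedComponentIn (planePreimage D) x ⊆ planePreimage D := by
    rintro _ ⟨w, hw, rfl⟩
    exact glide_mem_planePreimage (connectedComponentIn_subset _ _ hw) k
  rw [connectedComponentIn_eq hk]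
  exact h1.subset_connectedComponentIn ⟨y, hy, rfl⟩ h2
    ⟨x, mem_connectedComponentIn hx, rfl⟩

end PlanePreimage

/-- The covering of an annulus by the strip: it is invariant under `(x, y) ↦ (x + 2, y)`. -/
noncomputable def stripToPlane (z : ℝ × ℝ) : ℂ := Complex.exp (z.2 + Real.pi * z.1 * Complex.I)

theorem continuous_stripToPlane : Continuous stripToPlane := by
  unfold stripToPlane
  fun_prop

theorem isOpenMap_stripToPlane : IsOpenMap stripToPlane := by
  have h : stripToPlane = Complex.exp ∘ Complex.equivRealProdCLM.symm ∘
      (Prod.map id (Homeomorph.mulLeft₀ Real.pi Real.pi_ne_zero)) ∘ Prod.swap := by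
    ext z
    simp [stripToPlane, Complex.equivRealProdCLM_symm_apply]
  rw [h]
  exact Complex.isOpenMap_exp.comp ((Complex.equivRealProdCLM.symm.toHomeomorph.isOpenMap).comp
    ((IsOpenMap.id.prodMap (Homeomorph.isOpenMap _)).comp (Homeomorph.prodComm ℝ ℝ).isOpenMap))

theorem stripToPlane_eq_iff {z w : ℝ × ℝ} :
    stripToPlane z = stripToPlane w ↔ ∃ k : ℤ, Even k ∧ z = glide 1 k w := by
  rw [stripToPlane, stripToPlane, Complex.exp_eq_exp_iff_exists_int]
  constructor
  · rintro ⟨n, hn⟩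
    refine ⟨n + n, ⟨n, rfl⟩, ?_⟩
    rw [glide_of_even _ ⟨n, rfl⟩]
    have hre := congrArg Complex.re hn
    have him := congrArg Complex.im hn
    simp at hre him
    ext
    · apply mul_left_cancel₀ Real.pi_ne_zero
      push_cast
      linarith
    · exact hre
  · rintro ⟨k, ⟨n, hn⟩, rfl⟩
    refine ⟨n, ?_⟩
    rw [glide_of_even _ ⟨n, hn⟩, hn]
    push_cast
    ring

/-- Either some component of the plane preimage of `D` is preserved by an odd power of the glide
reflection, or `D` embeds into the plane. -/
theorem exists_odd_glide_or_planar {D : Set OpenMobius} (hDo : IsOpen D) (hDc : IsConnected D) :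
    (∃ z ∈ planePreimage D, ∃ k : ℤ, Odd k ∧
      glide 1 k z ∈ connectedComponentIn (planePreimage D) z) ∨
    ∃ ψ : OpenMobius → ℂ, ContinuousOn ψ D ∧ Set.InjOn ψ D ∧ IsOpen (ψ '' D) := by
  classical
  rw [or_iff_not_imp_left]
  intro hno
  obtain ⟨⟨p₀⟩, hp₀⟩ := hDc.nonempty
  set E := planePreimage D with hE
  have hEo : IsOpen E := isOpen_planePreimage hDo
  have hz₀ : p₀.1 ∈ E := val_mem_planePreimage.mpr hp₀
  set U := connectedComponentIn E p₀.1 with hU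
  have hUo : IsOpen U := hEo.connectedComponentIn
  have hUE : U ⊆ E := connectedComponentIn_subset _ _
  have hEg : ∀ (z : ℝ × ℝ) (k : ℤ), glide 1 k z ∈ E → z ∈ E := fun z k h => by
    simpa [glide_neg_glide] using glide_mem_planePreimage h (-k)
  have hcover : ∀ p : MobiusDom, Quot.mk mobiusRel p ∈ D → ∃ k : ℤ, glide 1 k p.1 ∈ U := by
    set A : Set MobiusDom := {p | ∃ k : ℤ, glide 1 k p.1 ∈ U} with hA
    set B : Set MobiusDom := {p | Quot.mk mobiusRel p ∈ D ∧ p ∉ A} with hB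
    have hAo : IsOpen A := by
      have : A = ⋃ k : ℤ, (fun p : MobiusDom => glide 1 k p.1) ⁻¹' U := by
        ext p
        simp [hA]
      rw [this]
      exact isOpen_iUnion fun k => hUo.preimage ((continuous_glide 1 k).comp continuous_subtype_val)
    have hBo : IsOpen B := by
      rw [isOpen_iff_mem_nhds]
      rintro p ⟨hpD, hpA⟩
      have hpE : p.1 ∈ E := val_mem_planePreimage.mpr hpD
      filter_upwards [(hEo.connectedComponentIn (x := p.1)).preimage continuous_subtype_val
        |>.mem_nhds (mem_connectedComponentIn hpE)] with q hq
      refine ⟨val_mem_planePreimage.mp (connectedComponentIn_subset _ _ hq), ?_⟩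
      rintro ⟨k, hk⟩
      exact hpA ⟨k, glide_mem_component hpE hq hk⟩
    have hAsat : ∀ p q : MobiusDom, Quot.mk mobiusRel p = Quot.mk mobiusRel q → q ∈ A → p ∈ A := by
      rintro p q hpq ⟨k, hk⟩
      obtain ⟨l, hl⟩ := mobius_mk_eq_iff.mp hpq
      refine ⟨k + l, ?_⟩
      rwa [← glide_glide, ← hl]
    have hsub : D ⊆ Quot.mk mobiusRel '' A := by
      refine hDc.isPreconnected.subset_left_of_subset_union (isOpenMap_mobius_mk _ hAo)
        (isOpenMap_mobius_mk _ hBo) ?_ ?_ ?_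
      · rw [Set.disjoint_left]
        rintro _ ⟨p, hp, rfl⟩ ⟨q, hq, hqp⟩
        exact hq.2 (hAsat _ _ hqp hp)
      · rintro ⟨p⟩ hp
        by_cases hpA : p ∈ A
        · exact Or.inl ⟨p, hpA, rfl⟩
        · exact Or.inr ⟨p, ⟨hp, hpA⟩, rfl⟩
      · exact ⟨_, hp₀, p₀, ⟨0, by rw [glide_zero]; exact mem_connectedComponentIn hz₀⟩, rfl⟩
    intro p hp
    obtain ⟨q, hq, hqp⟩ := hsub hp
    exact hAsat _ _ hqp.symm hq
  have hparity : ∀ (z : ℝ × ℝ) (k l : ℤ), glide 1 k z ∈ U → glide 1 l z ∈ U → Even (l - k) := by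
    intro z k l hk hl
    rw [← Int.not_odd_iff_even]
    intro hodd
    refine hno ⟨p₀.1, hz₀, l - k, hodd, glide_mem_component hz₀ hk ?_⟩
    rwa [glide_glide, sub_add_cancel]
  set W : Set MobiusDom := {p | ∃ k : ℤ, Even k ∧ glide 1 k p.1 ∈ U} with hW
  have hWo : IsOpen W := by
    have : W = ⋃ k : {k : ℤ // Even k}, (fun p : MobiusDom => glide 1 k.1 p.1) ⁻¹' U := by
      ext p
      simp [hW]
    rw [this]
    exact isOpen_iUnion fun k => hUo.preimage ((continuous_glide 1 _).comp continuous_subtype_val)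
  have hWD : ∀ p ∈ W, Quot.mk mobiusRel p ∈ D := by
    rintro p ⟨k, -, hk⟩
    exact val_mem_planePreimage.mp (hEg _ _ (hUE hk))
  have hWsurj : ∀ m ∈ D, ∃ p ∈ W, Quot.mk mobiusRel p = m := by
    rintro ⟨p⟩ hp
    obtain ⟨k, hk⟩ := hcover p hp
    rcases Int.even_or_odd k with he | ho
    · exact ⟨p, ⟨k, he, hk⟩, rfl⟩
    · refine ⟨⟨glide 1 1 p.1, glide_snd_mem p.2⟩, ⟨k - 1, ho.sub_odd odd_one, ?_⟩,
        (mobius_mk_eq_iff.mpr ⟨1, rfl⟩).symm⟩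
      rwa [glide_glide, sub_add_cancel]
  have hWφ : ∀ p ∈ W, ∀ q ∈ W, Quot.mk mobiusRel p = Quot.mk mobiusRel q →
      stripToPlane q.1 = stripToPlane p.1 := by
    rintro p ⟨k, hk, hkU⟩ q ⟨l, hl, hlU⟩ hpq
    obtain ⟨n, hn⟩ := mobius_mk_eq_iff.mp hpq
    refine stripToPlane_eq_iff.mpr ⟨n, ?_, hn⟩
    rw [hn, glide_glide] at hlU
    have := hparity _ _ _ hkU hlU
    rw [show n = (l + n - k) + k - l by ring]
    exact (this.add hk).sub hl
  let ψ : OpenMobius → ℂ := fun m =>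
    if h : ∃ p ∈ W, Quot.mk mobiusRel p = m then stripToPlane h.choose.1 else 0
  have hψ : ∀ p ∈ W, ψ (Quot.mk mobiusRel p) = stripToPlane p.1 := by
    intro p hp
    have h : ∃ q ∈ W, Quot.mk mobiusRel q = Quot.mk mobiusRel p := ⟨p, hp, rfl⟩
    simp only [ψ, dif_pos h]
    exact hWφ _ hp _ h.choose_spec.1 h.choose_spec.2.symm
  refine ⟨ψ, ?_, ?_, ?_⟩
  · intro m hm
    obtain ⟨p, hp, rfl⟩ := hWsurj m hm
    apply ContinuousAt.continuousWithinAt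
    rw [ContinuousAt, ← isOpenMap_mobius_mk.map_nhds_eq continuous_quot_mk.continuousAt,
      Filter.tendsto_map'_iff, hψ p hp]
    refine Filter.Tendsto.congr' (f₁ := fun q : MobiusDom => stripToPlane q.1) ?_
      (continuous_stripToPlane.comp continuous_subtype_val).continuousAt
    filter_upwards [hWo.mem_nhds hp] with q hq
    exact (hψ q hq).symm
  · intro m hm m' hm' h
    obtain ⟨p, hp, rfl⟩ := hWsurj m hm
    obtain ⟨q, hq, rfl⟩ := hWsurj m' hm'
    rw [hψ p hp, hψ q hq] at h
    obtain ⟨k, -, hk⟩ := stripToPlane_eq_iff.mp h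
    exact (mobius_mk_eq_iff.mpr ⟨k, hk⟩).symm
  · have : ψ '' D = stripToPlane '' (Subtype.val '' W) := by
      ext v
      constructor
      · rintro ⟨m, hm, rfl⟩
        obtain ⟨p, hp, rfl⟩ := hWsurj m hm
        exact ⟨p.1, ⟨p, hp, rfl⟩, (hψ p hp).symm⟩
      · rintro ⟨_, ⟨p, hp, rfl⟩, rfl⟩
        exact ⟨_, hWD p hp, hψ p hp⟩
    rw [this]
    exact isOpenMap_stripToPlane _ (((isOpen_Ioo.preimage
      continuous_snd).isOpenEmbedding_subtypeVal).isOpenMap _ hWo)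

/-- In an open set that embeds into the plane, every simple closed curve separates. -/
theorem not_isPreconnected_diff_of_planar {D γ : Set OpenMobius} {ψ : OpenMobius → ℂ}
    (hψ : ContinuousOn ψ D) (hinj : Set.InjOn ψ D) (hopen : IsOpen (ψ '' D))
    (hγ : IsSimpleClosedCurve γ) (hsub : γ ⊆ D) : ¬ IsPreconnected (D \ γ) := by
  obtain ⟨e⟩ := hγ
  intro h
  have hc : Continuous fun x : Circle2 => ψ (e.symm x) :=
    hψ.comp_continuous (continuous_subtype_val.comp e.symm.continuous)
      fun x => hsub (e.symm x).2
  have hci : Function.Injective fun x : Circle2 => ψ (e.symm x) := fun x y hxy =>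
    e.symm.injective (Subtype.ext (hinj (hsub (e.symm x).2) (hsub (e.symm y).2) hxy))
  have hr : Set.range (fun x : Circle2 => ψ (e.symm x)) = ψ '' γ := by
    ext v
    constructor
    · rintro ⟨x, rfl⟩
      exact ⟨_, (e.symm x).2, rfl⟩
    · rintro ⟨m, hm, rfl⟩
      exact ⟨e ⟨m, hm⟩, by simp⟩
  refine not_isPreconnected_diff_range hc hci hopen (hr ▸ Set.image_mono hsub) ?_
  rw [hr, ← hinj.image_sdiff_subset hsub]
  exact h.image _ (hψ.mono Set.sdiff_subset)

theorem exists_fun_of_reflTransGen {α : Type*} {r : α → α → Prop} {a b : α}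
    (h : Relation.ReflTransGen r a b) :
    ∃ (n : ℕ) (w : ℕ → α), w 0 = a ∧ w n = b ∧ ∀ i < n, r (w i) (w (i + 1)) := by
  induction h with
  | refl => exact ⟨0, fun _ => a, rfl, rfl, fun i hi => absurd hi (Nat.not_lt_zero i)⟩
  | @tail b c _ hbc ih =>
    obtain ⟨n, w, h0, hn, hw⟩ := ih
    refine ⟨n + 1, fun i => if i ≤ n then w i else c, by simpa using h0, by simp, fun i hi => ?_⟩
    rcases Nat.lt_succ_iff_lt_or_eq.mp hi with hi | rfl
    · simp only [hi.le, if_true, Nat.succ_le_of_lt hi]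
      exact hw i hi
    · simpa [hn] using hbc

/-- If a glide-invariant relation on the lattice connects a point to its image under an odd power
of the glide reflection, there is a periodic bi-infinite walk, reversed by its period, that visits
every orbit of the glide reflection at most once per period. -/
theorem exists_periodic_walk {r : ℤ × ℤ → ℤ × ℤ → Prop} {N : ℤ} (hN : N ≠ 0)
    (hr : ∀ k c c', r c c' → r (glide N k c) (glide N k c')) {k₀ : ℤ} (hk₀ : Odd k₀) {a : ℤ × ℤ}
    (h : Relation.ReflTransGen r a (glide N k₀ a)) :
    ∃ (n : ℕ) (k : ℤ) (c : ℤ → ℤ × ℤ), 0 < n ∧ Odd k ∧ (∀ i, r (c i) (c (i + 1))) ∧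
      (∀ i m : ℤ, c (i + m * n) = glide N (k * m) (c i)) ∧
      ∀ i j l, c i = glide N l (c j) → (n : ℤ) ∣ i - j := by
  classical
  let Q : ℕ → Prop := fun n => ∃ (w : ℕ → ℤ × ℤ) (k : ℤ), Odd k ∧
    (∀ i < n, r (w i) (w (i + 1))) ∧ w n = glide N k (w 0)
  have hQ : ∃ n, Q n := by
    obtain ⟨n, w, h0, hn, hw⟩ := exists_fun_of_reflTransGen h
    exact ⟨n, w, k₀, hk₀, hw, by rw [hn, h0]⟩
  obtain ⟨w, k, hk, hw, hwn⟩ := Nat.find_spec hQ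
  have hmin : ∀ m, m < Nat.find hQ → ¬ Q m := fun m => Nat.find_min hQ
  set n := Nat.find hQ
  have hn : 0 < n := by
    refine Nat.pos_of_ne_zero fun h0 => ?_
    rw [h0] at hwn
    have h1 : (w 0).1 = (w 0).1 + k * N := congrArg Prod.fst hwn
    have h2 : k * N = 0 := by linarith
    rcases mul_eq_zero.mp h2 with h3 | h3
    · rw [h3] at hk
      exact absurd hk (by decide)
    · exact hN h3
  have hn' : (0 : ℤ) < n := by exact_mod_cast hn
  let c : ℤ → ℤ × ℤ := fun i => glide N (k * (i / n)) (w (i % n).toNat)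
  have hc : ∀ (q : ℤ) (m : ℕ), m < n → c (m + q * n) = glide N (k * q) (w m) := by
    intro q m hm
    have hm' : (m : ℤ) < n := by exact_mod_cast hm
    have h1 : ((m : ℤ) + q * n) / n = q := by
      rw [Int.add_mul_ediv_right _ _ hn'.ne', Int.ediv_eq_zero_of_lt (by positivity) hm', zero_add]
    have h2 : ((m : ℤ) + q * n) % n = m := by
      rw [Int.add_mul_emod_self_right, Int.emod_eq_of_lt (by positivity) hm']
    simp only [c, h1, h2, Int.toNat_natCast]
  have hdecomp : ∀ i : ℤ, ∃ (q : ℤ) (m : ℕ), m < n ∧ i = m + q * n := by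
    intro i
    have h0 := Int.emod_nonneg i hn'.ne'
    refine ⟨i / n, (i % n).toNat, ?_, ?_⟩
    · have := Int.emod_lt_of_pos i hn'
      omega
    · rw [Int.toNat_of_nonneg h0, mul_comm]
      exact (Int.emod_add_mul_ediv i n).symm
  have hper : ∀ i m : ℤ, c (i + m * n) = glide N (k * m) (c i) := by
    intro i m
    obtain ⟨q, j, hj, rfl⟩ := hdecomp i
    rw [show (j : ℤ) + q * n + m * n = j + (q + m) * n by ring, hc _ _ hj, hc _ _ hj, glide_glide]
    congr 1
    ring
  have hstep : ∀ i, r (c i) (c (i + 1)) := by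
    intro i
    obtain ⟨q, j, hj, rfl⟩ := hdecomp i
    have : c (j + q * n + 1) = glide N (k * q) (w (j + 1)) := by
      rcases Nat.lt_or_ge (j + 1) n with h1 | h1
      · rw [← hc _ _ h1]
        congr 1
        push_cast
        ring
      · have h2 : j + 1 = n := le_antisymm hj h1
        rw [h2, hwn, glide_glide, show k * q + k = k * (q + 1) by ring, ← hc _ _ hn]
        congr 1
        rw [← h2]
        push_cast
        ring
    rw [this, hc _ _ hj]
    exact hr _ _ _ (hw j hj)
  refine ⟨n, k, c, hn, hk, hstep, hper, fun i j l hij => ?_⟩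
  by_contra hdvd
  obtain ⟨q, d, hd, hid⟩ := hdecomp (i - j)
  have hd0 : 0 < d := by
    refine Nat.pos_of_ne_zero fun h0 => hdvd ⟨q, ?_⟩
    rw [hid, h0]
    push_cast
    ring
  have hjd : c (j + d) = glide N (l - k * q) (c j) := by
    apply glide_injective N (k * q)
    have e : glide N (k * q) (glide N (l - k * q) (c j)) = glide N l (c j) := by
      rw [glide_glide, add_sub_cancel]
    rw [e, ← hper, ← hij]
    congr 1
    linarith
  rcases Int.even_or_odd (l - k * q) with he | ho
  · refine hmin (n - d) (by omega) ⟨fun m => c (j + d + m), k - (l - k * q), hk.sub_even he,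
      fun m _ => ?_, ?_⟩
    · simpa [add_assoc] using hstep (j + d + m)
    · simp only [Nat.cast_zero, add_zero]
      rw [hjd, glide_glide, sub_add_cancel, Nat.cast_sub hd.le]
      have := hper j 1
      rw [one_mul, mul_one] at this
      rw [← this]
      congr 1
      ring
  · refine hmin d hd ⟨fun m => c (j + m), l - k * q, ho, fun m _ => ?_, ?_⟩
    · simpa [add_assoc] using hstep (j + m)
    · simpa using hjd

/-- The point `z` lies in the closed square of side `1 / N` centred at the lattice point `c`. -/
def InCell (N : ℕ) (z : ℝ × ℝ) (c : ℤ × ℤ) : Prop :=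
  |N * z.1 - c.1| ≤ 1 / 2 ∧ |N * z.2 - c.2| ≤ 1 / 2

/-- Two grid squares of side `1 / N` share an edge and are contained in `E`. -/
def CellAdj (E : Set (ℝ × ℝ)) (N : ℕ) (c c' : ℤ × ℤ) : Prop :=
  (∀ z, InCell N z c → z ∈ E) ∧ (∀ z, InCell N z c' → z ∈ E) ∧
    |c'.1 - c.1| + |c'.2 - c.2| = 1

theorem exists_inCell (N : ℕ) (z : ℝ × ℝ) : ∃ c, InCell N z c :=
  ⟨(round (N * z.1), round (N * z.2)), abs_sub_round _, abs_sub_round _⟩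

theorem InCell.map_glide {N : ℕ} (hN : N ≠ 0) {z : ℝ × ℝ} {c : ℤ × ℤ} (h : InCell N z c) (k : ℤ) :
    InCell N (glide 1 k z) (glide (N : ℤ) k c) := by
  have hN' : (N : ℝ) ≠ 0 := by exact_mod_cast hN
  rcases Int.even_or_odd k with hk | hk
  · rw [glide_of_even _ hk, glide_of_even _ hk]
    refine ⟨?_, h.2⟩
    push_cast
    convert h.1 using 2
    ring
  · rw [glide_of_odd _ hk, glide_of_odd _ hk]
    refine ⟨?_, ?_⟩
    · push_cast
      convert h.1 using 2
      ring
    · push_cast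
      rw [← abs_neg]
      convert h.2 using 2
      ring

theorem reflTransGen_cellAdj_of_box {E : Set (ℝ × ℝ)} {N : ℕ} {c c' : ℤ × ℤ}
    (h : ∀ a ∈ Set.uIcc c.1 c'.1, ∀ b ∈ Set.uIcc c.2 c'.2, ∀ z, InCell N z (a, b) → z ∈ E) :
    Relation.ReflTransGen (CellAdj E N) c c' := by
  have mem : ∀ {x y i : ℤ}, min x y ≤ i → i ≤ max x y → i ∈ Set.uIcc x y := fun h1 h2 => ⟨h1, h2⟩
  have h1 : Relation.ReflTransGen (fun a a' : ℤ => CellAdj E N (a, c.2) (a', c.2)) c.1 c'.1 := by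
    refine reflTransGen_of_succ _ (fun i hi => ?_) (fun i hi => ?_)
    · refine ⟨h _ (mem ?_ ?_) _ Set.left_mem_uIcc, h _ (mem ?_ ?_) _ Set.left_mem_uIcc, by simp⟩ <;>
        have := hi.1 <;> have := hi.2 <;> (try simp only [Order.succ_eq_add_one]) <;> omega
    · refine ⟨h _ (mem ?_ ?_) _ Set.left_mem_uIcc, h _ (mem ?_ ?_) _ Set.left_mem_uIcc, by simp⟩ <;>
        have := hi.1 <;> have := hi.2 <;> (try simp only [Order.succ_eq_add_one]) <;> omega
  have h2 : Relation.ReflTransGen (fun b b' : ℤ => CellAdj E N (c'.1, b) (c'.1, b')) c.2 c'.2 := by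
    refine reflTransGen_of_succ _ (fun i hi => ?_) (fun i hi => ?_)
    · refine ⟨h _ Set.right_mem_uIcc _ (mem ?_ ?_), h _ Set.right_mem_uIcc _ (mem ?_ ?_),
        by simp⟩ <;>
        have := hi.1 <;> have := hi.2 <;> (try simp only [Order.succ_eq_add_one]) <;> omega
    · refine ⟨h _ Set.right_mem_uIcc _ (mem ?_ ?_), h _ Set.right_mem_uIcc _ (mem ?_ ?_),
        by simp⟩ <;>
        have := hi.1 <;> have := hi.2 <;> (try simp only [Order.succ_eq_add_one]) <;> omega
  exact (h1.lift (fun a => (a, c.2)) fun _ _ h => h).trans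
    (h2.lift (fun b => (c'.1, b)) fun _ _ h => h)

theorem abs_sub_lt_of_mem_uIcc {a b i : ℤ} {x y w δ : ℝ} (hi : i ∈ Set.uIcc a b)
    (ha : |x - a| ≤ 1 / 2) (hb : |y - b| ≤ 1 / 2) (hw : |w - i| ≤ 1 / 2) (hxy : |y - x| < δ) :
    |w - x| < 1 + δ := by
  rw [abs_le] at ha hb hw
  rw [abs_lt] at hxy ⊢
  rcases le_total a b with hab | hab
  · rw [Set.uIcc_of_le hab] at hi
    have h1 : (a : ℝ) ≤ i := by exact_mod_cast hi.1
    have h2 : (i : ℝ) ≤ b := by exact_mod_cast hi.2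
    constructor <;> linarith
  · rw [Set.uIcc_of_ge hab] at hi
    have h1 : (b : ℝ) ≤ i := by exact_mod_cast hi.1
    have h2 : (i : ℝ) ≤ a := by exact_mod_cast hi.2
    constructor <;> linarith

/-- Two points of a connected subset of the open set `E` lie in grid squares that are joined by a
chain of squares inside `E`, once the grid is fine enough. -/
theorem eventually_reflTransGen_cellAdj {E U : Set (ℝ × ℝ)} (hE : IsOpen E)
    (hU : IsPreconnected U) (hUE : U ⊆ E) {x y : ℝ × ℝ} (hx : x ∈ U) (hy : y ∈ U) :
    ∀ᶠ N : ℕ in Filter.atTop, ∀ c c', InCell N x c → InCell N y c' →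
      Relation.ReflTransGen (CellAdj E N) c c' := by
  refine hU.induction₂ (fun x y => ∀ᶠ N : ℕ in Filter.atTop, ∀ c c', InCell N x c →
    InCell N y c' → Relation.ReflTransGen (CellAdj E N) c c') ?_ ?_ ?_ hx hy
  · intro x hx
    obtain ⟨ε, hε, hball⟩ := Metric.isOpen_iff.mp hE x (hUE hx)
    apply mem_nhdsWithin_of_mem_nhds
    filter_upwards [Metric.ball_mem_nhds x (half_pos hε)] with y hy
    obtain ⟨N₀, hN₀⟩ := exists_nat_gt (2 / ε)
    filter_upwards [Filter.eventually_ge_atTop N₀] with N hN c c' hc hc'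
    have hN' : 2 / ε < N := hN₀.trans_le (by exact_mod_cast hN)
    have hNε : 2 < N * ε := (div_lt_iff₀ hε).mp hN'
    have hNpos : (0 : ℝ) < N := (by positivity : 0 < 2 / ε).trans hN'
    rw [Metric.mem_ball, Prod.dist_eq, max_lt_iff, Real.dist_eq, Real.dist_eq] at hy
    have hmul : ∀ {u v : ℝ} {δ : ℝ}, |N * u - N * v| < N * δ ↔ |u - v| < δ := by
      intro u v δ
      rw [← mul_sub, abs_mul, abs_of_pos hNpos, mul_lt_mul_iff_right₀ hNpos]
    refine reflTransGen_cellAdj_of_box fun a ha b hb z hz => hball ?_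
    rw [Metric.mem_ball, Prod.dist_eq, max_lt_iff, Real.dist_eq, Real.dist_eq]
    constructor
    · have := abs_sub_lt_of_mem_uIcc ha hc.1 hc'.1 hz.1 (hmul.mpr hy.1)
      exact hmul.mp (this.trans (by linarith))
    · have := abs_sub_lt_of_mem_uIcc hb hc.2 hc'.2 hz.2 (hmul.mpr hy.2)
      exact hmul.mp (this.trans (by linarith))
  · intro x y z _ _ _ hxy hyz
    filter_upwards [hxy, hyz] with N h1 h2 c c' hc hc'
    obtain ⟨d, hd⟩ := exists_inCell N y
    exact (h1 c d hc hd).trans (h2 d c' hd hc')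
  · intro x y _ _ hxy
    filter_upwards [hxy] with N h c c' hc hc'
    have : Std.Symm (CellAdj E N) :=
      ⟨fun a b ⟨ha, hb, hab⟩ => ⟨hb, ha, by rwa [abs_sub_comm a.1, abs_sub_comm a.2]⟩⟩
    exact Std.Symm.symm _ _ (h c' c hc' hc)

/-- Piecewise linear interpolation of a function on the integers. -/
noncomputable def interp (g : ℤ → ℝ) (x : ℝ) : ℝ :=
  (1 - Int.fract x) * g ⌊x⌋ + Int.fract x * g (⌊x⌋ + 1)

theorem interp_add_intCast (g : ℤ → ℝ) (x : ℝ) (m : ℤ) :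
    interp g (x + m) = interp (fun i => g (i + m)) x := by
  simp only [interp, Int.fract_add_intCast, Int.floor_add_intCast, add_right_comm]

theorem interp_of_mem_Icc (g : ℤ → ℝ) {x : ℝ} {i : ℤ} (hx : x ∈ Set.Icc (i : ℝ) (i + 1)) :
    interp g x = (1 - (x - i)) * g i + (x - i) * g (i + 1) := by
  rcases hx.2.lt_or_eq with h | h
  · have hi : ⌊x⌋ = i := Int.floor_eq_iff.mpr ⟨hx.1, h⟩
    rw [interp, Int.fract, hi]
  · have hi : ⌊x⌋ = i + 1 := by
      rw [h]
      simp
    rw [interp, Int.fract, hi, h]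
    push_cast
    ring

theorem continuous_interp (g : ℤ → ℝ) : Continuous (interp g) := by
  have hlf : LocallyFinite fun i : ℤ => Set.Icc (i : ℝ) (i + 1) := by
    intro x
    refine ⟨Set.Ioo (x - 1) (x + 1), Ioo_mem_nhds (by linarith) (by linarith),
      (Set.finite_Icc (⌊x⌋ - 2) (⌊x⌋ + 2)).subset ?_⟩
    rintro i ⟨y, hy, hy'⟩
    have h1 := Int.floor_le x
    have h2 := Int.lt_floor_add_one x
    have h3 : (i : ℝ) < ⌊x⌋ + 2 := by linarith [hy.1, hy'.2]
    have h4 : (⌊x⌋ : ℝ) < i + 2 := by linarith [hy.2, hy'.1]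
    have h5 : i < ⌊x⌋ + 2 := by exact_mod_cast h3
    have h6 : ⌊x⌋ < i + 2 := by exact_mod_cast h4
    exact ⟨by linarith, by linarith⟩
  refine hlf.continuous (Set.eq_univ_of_forall fun x => Set.mem_iUnion.mpr
    ⟨⌊x⌋, Int.floor_le x, (Int.lt_floor_add_one x).le⟩) (fun i => isClosed_Icc) fun i => ?_
  refine ContinuousOn.congr (f := fun x => (1 - (x - i)) * g i + (x - i) * g (i + 1)) ?_
    fun x hx => interp_of_mem_Icc g hx
  fun_prop

/-- The band of half-width `1 / 4` that follows the lattice walk `c`: the parameter `x` runs along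
the midpoints of the edges of the walk, and `s` is the offset to the left. -/
noncomputable def band (c : ℤ → ℤ × ℤ) (x s : ℝ) : ℝ × ℝ :=
  (interp (fun i => (((c i).1 + (c (i + 1)).1 : ℤ) : ℝ) / 2) x
      - s * interp (fun i => (((c (i + 1)).2 - (c i).2 : ℤ) : ℝ)) x,
    interp (fun i => (((c i).2 + (c (i + 1)).2 : ℤ) : ℝ) / 2) x
      + s * interp (fun i => (((c (i + 1)).1 - (c i).1 : ℤ) : ℝ)) x)

theorem continuous_band (c : ℤ → ℤ × ℤ) : Continuous fun z : ℝ × ℝ => band c z.1 z.2 := by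
  unfold band
  have := fun g => (continuous_interp g).comp (continuous_fst (X := ℝ) (Y := ℝ))
  exact ((this _).sub (continuous_snd.mul (this _))).prodMk
    ((this _).add (continuous_snd.mul (this _)))

theorem band_add_intCast (c : ℤ → ℤ × ℤ) (x s : ℝ) (m : ℤ) :
    band c (x + m) s = band (fun i => c (i + m)) x s := by
  simp only [band, interp_add_intCast, add_right_comm]

theorem band_glide (c : ℤ → ℤ × ℤ) (N k : ℤ) (x s : ℝ) :
    band (fun i => glide N k (c i)) x s =
      glide (N : ℝ) k (band c x (((k.negOnePow : ℤ) : ℝ) * s)) := by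
  rcases Int.even_or_odd k with hk | hk
  · simp only [glide_of_even _ hk, Int.negOnePow_even k hk, band, interp]
    ext <;> push_cast <;> ring
  · simp only [glide_of_odd _ hk, Int.negOnePow_odd k hk, band, interp]
    ext <;> push_cast <;> ring

theorem negOnePow_mul_of_odd {k : ℤ} (hk : Odd k) (m : ℤ) : (k * m).negOnePow = m.negOnePow := by
  rw [Int.negOnePow_eq_iff, show k * m - m = (k - 1) * m by ring]
  exact (hk.sub_odd odd_one).mul_right m

theorem negOnePow_mul_self_mul (k : ℤ) (s : ℝ) :
    ((k.negOnePow : ℤ) : ℝ) * (((k.negOnePow : ℤ) : ℝ) * s) = s := by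
  rcases Int.even_or_odd k with hk | hk
  · simp [Int.negOnePow_even k hk]
  · simp [Int.negOnePow_odd k hk]

theorem abs_negOnePow_mul (k : ℤ) (s : ℝ) : |((k.negOnePow : ℤ) : ℝ) * s| = |s| := by
  rcases Int.even_or_odd k with hk | hk
  · simp [Int.negOnePow_even k hk]
  · simp [Int.negOnePow_odd k hk]

/-- The band near the lattice point at which the walk arrives in direction `u` and which it leaves
in direction `v`. -/
noncomputable def turn (u v : ℤ × ℤ) (t s : ℝ) : ℝ × ℝ :=
  ((1 - t) * (-u.1 / 2 - s * u.2) + t * (v.1 / 2 - s * v.2),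
    (1 - t) * (-u.2 / 2 + s * u.1) + t * (v.2 / 2 + s * v.1))

theorem band_eq_turn (c : ℤ → ℤ × ℤ) (x s : ℝ) :
    band c x s = ((c (⌊x⌋ + 1)).1 + (turn (c (⌊x⌋ + 1) - c ⌊x⌋) (c (⌊x⌋ + 1 + 1) - c (⌊x⌋ + 1))
        (Int.fract x) s).1,
      (c (⌊x⌋ + 1)).2 + (turn (c (⌊x⌋ + 1) - c ⌊x⌋) (c (⌊x⌋ + 1 + 1) - c (⌊x⌋ + 1))
        (Int.fract x) s).2) := by
  simp only [band, interp, turn, Prod.fst_sub, Prod.snd_sub]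
  ext <;> push_cast <;> ring

theorem eq_of_abs_add_abs_eq_one {u : ℤ × ℤ} (h : |u.1| + |u.2| = 1) :
    u = (1, 0) ∨ u = (-1, 0) ∨ u = (0, 1) ∨ u = (0, -1) := by
  obtain ⟨a, b⟩ := u
  simp only [Prod.mk.injEq] at h ⊢
  rcases abs_cases a with ⟨h1, _⟩ | ⟨h1, _⟩ <;> rcases abs_cases b with ⟨h2, _⟩ | ⟨h2, _⟩ <;> omega

section Turn

variable {u v : ℤ × ℤ} {t s : ℝ}

theorem abs_turn_le (hu : |u.1| + |u.2| = 1) (hv : |v.1| + |v.2| = 1) (ht0 : 0 ≤ t) (ht1 : t ≤ 1)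
    (hs : |s| < 1 / 4) : |(turn u v t s).1| ≤ 1 / 2 ∧ |(turn u v t s).2| ≤ 1 / 2 := by
  obtain ⟨hs1, hs2⟩ := abs_lt.mp hs
  have p1 := mul_nonneg ht0 (sub_nonneg.mpr hs2.le)
  have p2 := mul_nonneg ht0 (sub_nonneg.mpr hs1.le)
  have p3 := mul_nonneg (sub_nonneg.mpr ht1) (sub_nonneg.mpr hs2.le)
  have p4 := mul_nonneg (sub_nonneg.mpr ht1) (sub_nonneg.mpr hs1.le)
  rcases eq_of_abs_add_abs_eq_one hu with rfl | rfl | rfl | rfl <;>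
  rcases eq_of_abs_add_abs_eq_one hv with rfl | rfl | rfl | rfl <;>
  · simp only [turn, abs_le]
    push_cast
    refine ⟨⟨?_, ?_⟩, ?_, ?_⟩ <;> linarith

theorem abs_turn_lt (hu : |u.1| + |u.2| = 1) (hv : |v.1| + |v.2| = 1) (huv : u + v ≠ 0)
    (ht0 : 0 < t) (ht1 : t < 1) (hs : |s| < 1 / 4) :
    |(turn u v t s).1| < 1 / 2 ∧ |(turn u v t s).2| < 1 / 2 := by
  obtain ⟨hs1, hs2⟩ := abs_lt.mp hs
  have p1 := mul_pos ht0 (sub_pos.mpr hs2)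
  have p2 := mul_pos ht0 (sub_pos.mpr hs1)
  have p3 := mul_pos (sub_pos.mpr ht1) (sub_pos.mpr hs2)
  have p4 := mul_pos (sub_pos.mpr ht1) (sub_pos.mpr hs1)
  rcases eq_of_abs_add_abs_eq_one hu with rfl | rfl | rfl | rfl <;>
  rcases eq_of_abs_add_abs_eq_one hv with rfl | rfl | rfl | rfl <;>
  first
  | exact absurd rfl huv
  | simp only [turn, abs_lt]
    push_cast
    refine ⟨⟨?_, ?_⟩, ?_, ?_⟩ <;> linarith

theorem turn_injective (hu : |u.1| + |u.2| = 1) (hv : |v.1| + |v.2| = 1) (huv : u + v ≠ 0)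
    {t' s' : ℝ} (hs : |s| < 1 / 4) (h : turn u v t s = turn u v t' s') : t = t' ∧ s = s' := by
  obtain ⟨hs1, hs2⟩ := abs_lt.mp hs
  have h1 : (turn u v t s).1 = (turn u v t' s').1 := congrArg Prod.fst h
  have h2 : (turn u v t s).2 = (turn u v t' s').2 := congrArg Prod.snd h
  have hss : s = s' := by
    rcases eq_of_abs_add_abs_eq_one hu with rfl | rfl | rfl | rfl <;>
    rcases eq_of_abs_add_abs_eq_one hv with rfl | rfl | rfl | rfl <;>
    first
    | exact absurd rfl huv
    | simp only [turn] at h1 h2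
      push_cast at h1 h2
      linarith
  subst hss
  refine ⟨?_, rfl⟩
  have p1 : (t - t') * (1 / 2 + s) = 0 → t = t' := fun h => by
    rcases mul_eq_zero.mp h with h | h <;> linarith
  have p2 : (t - t') * (1 / 2 - s) = 0 → t = t' := fun h => by
    rcases mul_eq_zero.mp h with h | h <;> linarith
  rcases eq_of_abs_add_abs_eq_one hu with rfl | rfl | rfl | rfl <;>
  rcases eq_of_abs_add_abs_eq_one hv with rfl | rfl | rfl | rfl <;>
  first
  | exact absurd rfl huv
  | simp only [turn] at h1 h2
    push_cast at h1 h2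
    first
    | linarith
    | exact p1 (by linarith)
    | exact p2 (by linarith)

end Turn

theorem eq_or_swap_of_add_eq {a a' b b' : ℤ × ℤ} (hu : |a'.1 - a.1| + |a'.2 - a.2| = 1)
    (hv : |b'.1 - b.1| + |b'.2 - b.2| = 1) (h : a + a' = b + b') : a' = b' ∨ a' = b ∧ a = b' := by
  obtain ⟨u, rfl⟩ : ∃ u, a' = a + u := ⟨a' - a, (add_sub_cancel _ _).symm⟩
  obtain ⟨v, rfl⟩ : ∃ v, b' = b + v := ⟨b' - b, (add_sub_cancel _ _).symm⟩
  simp only [Prod.fst_add, Prod.snd_add, add_sub_cancel_left] at hu hv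
  obtain ⟨a₁, a₂⟩ := a
  obtain ⟨b₁, b₂⟩ := b
  rcases eq_of_abs_add_abs_eq_one hu with rfl | rfl | rfl | rfl <;>
  rcases eq_of_abs_add_abs_eq_one hv with rfl | rfl | rfl | rfl <;>
  · simp only [Prod.mk_add_mk, Prod.mk.injEq] at h ⊢
    omega

/-- A lattice walk all of whose steps are unit steps and that never backtracks. -/
def IsUnitWalk (c : ℤ → ℤ × ℤ) : Prop :=
  (∀ i, |(c (i + 1)).1 - (c i).1| + |(c (i + 1)).2 - (c i).2| = 1) ∧ ∀ i, c (i + 1 + 1) ≠ c i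

namespace IsUnitWalk

variable {c c' : ℤ → ℤ × ℤ}

theorem add_ne_zero (hc : IsUnitWalk c) (i : ℤ) :
    (c (i + 1) - c i) + (c (i + 1 + 1) - c (i + 1)) ≠ 0 := by
  rw [add_comm, sub_add_sub_cancel]
  exact sub_ne_zero.mpr (hc.2 i)

theorem map_glide (hc : IsUnitWalk c) (N k : ℤ) : IsUnitWalk fun i => glide N k (c i) := by
  refine ⟨fun i => ?_, fun i h => hc.2 i (glide_injective N k h)⟩
  refine Eq.trans ?_ (hc.1 i)
  rcases Int.even_or_odd k with hk | hk
  · simp only [glide_of_even _ hk, add_sub_add_right_eq_sub]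
  · simp only [glide_of_odd _ hk, add_sub_add_right_eq_sub]
    rw [← abs_neg (-(c (i + 1)).2 - -(c i).2), neg_sub_neg, neg_sub]

theorem abs_band_sub_le (hc : IsUnitWalk c) (x : ℝ) {s : ℝ} (hs : |s| < 1 / 4) :
    |(band c x s).1 - (c (⌊x⌋ + 1)).1| ≤ 1 / 2 ∧ |(band c x s).2 - (c (⌊x⌋ + 1)).2| ≤ 1 / 2 := by
  rw [band_eq_turn]
  simp only [add_sub_cancel_left]
  exact abs_turn_le (hc.1 _) (hc.1 _) (Int.fract_nonneg x) (Int.fract_lt_one x).le hs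

theorem abs_band_sub_lt (hc : IsUnitWalk c) {x : ℝ} (hx : Int.fract x ≠ 0) {s : ℝ}
    (hs : |s| < 1 / 4) :
    |(band c x s).1 - (c (⌊x⌋ + 1)).1| < 1 / 2 ∧ |(band c x s).2 - (c (⌊x⌋ + 1)).2| < 1 / 2 := by
  rw [band_eq_turn]
  simp only [add_sub_cancel_left]
  exact abs_turn_lt (hc.1 _) (hc.1 _) (hc.add_ne_zero _)
    (lt_of_le_of_ne (Int.fract_nonneg x) hx.symm) (Int.fract_lt_one x) hs

theorem eq_of_band_eq (hc : IsUnitWalk c) {x y s s' : ℝ} (hxy : ⌊x⌋ = ⌊y⌋) (hs : |s| < 1 / 4)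
    (h : band c x s = band c y s') : x = y ∧ s = s' := by
  rw [band_eq_turn, band_eq_turn, hxy, Prod.mk.injEq] at h
  obtain ⟨h1, h2⟩ := turn_injective (hc.1 _) (hc.1 _) (hc.add_ne_zero ⌊y⌋) hs
    (Prod.ext (add_left_cancel h.1) (add_left_cancel h.2))
  refine ⟨?_, h2⟩
  rw [← Int.floor_add_fract x, ← Int.floor_add_fract y, hxy, h1]

theorem eq_or_swap_of_band_eq (hc : IsUnitWalk c) (hc' : IsUnitWalk c') {x y s s' : ℝ}
    (hs : |s| < 1 / 4) (hs' : |s'| < 1 / 4) (h : band c x s = band c' y s') :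
    c (⌊x⌋ + 1) = c' (⌊y⌋ + 1) ∨ c (⌊x⌋ + 1) = c' ⌊y⌋ ∧ c ⌊x⌋ = c' (⌊y⌋ + 1) := by
  have key : ∀ {a b : ℤ}, |(a : ℝ) - b| < 1 → a = b := fun {a b} hab => by
    have : |a - b| < 1 := by exact_mod_cast hab
    exact sub_eq_zero.mp (Int.abs_lt_one_iff.mp this)
  have tri : ∀ {a b w : ℝ}, |w - a| + |w - b| < 1 → |a - b| < 1 := fun {a b w} hw => by
    rw [abs_sub_comm w a] at hw
    exact (abs_sub_le a w b).trans_lt hw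
  by_cases hx : Int.fract x = 0
  · by_cases hy : Int.fract y = 0
    · obtain ⟨hs1, hs2⟩ := abs_lt.mp hs
      obtain ⟨hs1', hs2'⟩ := abs_lt.mp hs'
      have hu := hc.1 ⌊x⌋
      have hu' := hc'.1 ⌊y⌋
      have hd : ∀ {a b : ℤ}, |a| + |b| = 1 → |(a : ℝ)| ≤ 1 ∧ |(b : ℝ)| ≤ 1 := fun {a b} hab => by
        constructor
        · exact_mod_cast (le_add_of_nonneg_right (abs_nonneg b)).trans_eq hab
        · exact_mod_cast (le_add_of_nonneg_left (abs_nonneg a)).trans_eq hab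
      have hsm : ∀ {r w : ℝ}, |r| < 1 / 4 → |w| ≤ 1 → |r * w| < 1 / 4 := fun {r w} hr hw => by
        rw [abs_mul]
        exact (mul_le_of_le_one_right (abs_nonneg r) hw).trans_lt hr
      have k1 := abs_lt.mp (hsm hs (hd hu).1)
      have k2 := abs_lt.mp (hsm hs (hd hu).2)
      have k3 := abs_lt.mp (hsm hs' (hd hu').1)
      have k4 := abs_lt.mp (hsm hs' (hd hu').2)
      simp only [band, interp, hx, hy, Prod.mk.injEq] at h
      obtain ⟨h1, h2⟩ := h
      refine eq_or_swap_of_add_eq hu hu' (Prod.ext (key ?_) (key ?_)) <;>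
      · rw [abs_lt]
        push_cast [Prod.fst_add, Prod.snd_add] at k1 k2 k3 k4 h1 h2 ⊢
        constructor <;> linarith
    · left
      have h1 := hc.abs_band_sub_le x hs
      have h2 := hc'.abs_band_sub_lt hy hs'
      rw [← h] at h2
      exact Prod.ext (key (tri (by linarith [h1.1, h2.1]))) (key (tri (by linarith [h1.2, h2.2])))
  · left
    have h1 := hc.abs_band_sub_lt hx hs
    have h2 := hc'.abs_band_sub_le y hs'
    rw [← h] at h2
    exact Prod.ext (key (tri (by linarith [h1.1, h2.1]))) (key (tri (by linarith [h1.2, h2.2])))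

end IsUnitWalk

/-- The band along a periodic walk meets its glide images only as prescribed by the period. -/
theorem IsUnitWalk.exists_of_band_eq_glide_band {c : ℤ → ℤ × ℤ} (hc : IsUnitWalk c) {N : ℤ}
    (hN : N ≠ 0) {n : ℕ} {k : ℤ} (hn : 3 ≤ n)
    (hper : ∀ i m : ℤ, c (i + m * n) = glide N (k * m) (c i))
    (hinj : ∀ i j l, c i = glide N l (c j) → (n : ℤ) ∣ i - j) {x y s s' : ℝ} {l : ℤ}
    (hs : |s| < 1 / 4) (hs' : |s'| < 1 / 4)
    (h : band c x s = glide (N : ℝ) l (band c y s')) :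
    ∃ m : ℤ, l = k * m ∧ x = y + m * n ∧ s = ((l.negOnePow : ℤ) : ℝ) * s' := by
  set σ : ℝ → ℝ := fun r => ((l.negOnePow : ℤ) : ℝ) * r with hσ
  have hσs : |σ s| < 1 / 4 := by rwa [hσ, abs_negOnePow_mul]
  have hσs' : |σ s'| < 1 / 4 := by rwa [hσ, abs_negOnePow_mul]
  have h' : band c x s = band (fun i => glide N l (c i)) y (σ s') := by
    rw [band_glide, hσ, negOnePow_mul_self_mul, h]
  rcases hc.eq_or_swap_of_band_eq (hc.map_glide N l) hs hσs' h' with h1 | ⟨h1, h2⟩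
  · obtain ⟨m, hm⟩ := hinj _ _ _ h1
    have hx : ⌊x⌋ = ⌊y⌋ + m * n := by linarith
    have hl : l = k * m := by
      rw [hx, add_right_comm, hper] at h1
      have h2 := congrArg Prod.fst h1
      simp only [glide] at h2
      exact (mul_right_cancel₀ hN (add_left_cancel h2)).symm
    have h3 : band c (x - (m * n : ℤ)) (σ s) = band c y s' := by
      apply glide_injective (N : ℝ) l
      rw [← h, ← band_glide, hl]
      simp only [← hper]
      rw [← band_add_intCast, sub_add_cancel]
    obtain ⟨h4, h5⟩ := hc.eq_of_band_eq (by rw [Int.floor_sub_intCast, hx, add_sub_cancel_right])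
      hσs h3
    refine ⟨m, hl, ?_, ?_⟩
    · rw [← h4]
      push_cast
      ring
    · rw [← h5, hσ, negOnePow_mul_self_mul]
  · have h3 := dvd_sub (hinj _ _ _ h1) (hinj _ _ _ h2)
    rw [show ⌊x⌋ + 1 - ⌊y⌋ - (⌊x⌋ - (⌊y⌋ + 1)) = 2 by ring] at h3
    have := Int.le_of_dvd two_pos h3
    omega

theorem CellAdj.map_glide {D : Set OpenMobius} {N : ℕ} (hN : N ≠ 0) {c c' : ℤ × ℤ}
    (h : CellAdj (planePreimage D) N c c') (k : ℤ) :
    CellAdj (planePreimage D) N (glide (N : ℤ) k c) (glide (N : ℤ) k c') := by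
  have key : ∀ c, (∀ z, InCell N z c → z ∈ planePreimage D) → ∀ z,
      InCell N z (glide (N : ℤ) k c) → z ∈ planePreimage D := by
    intro c hc z hz
    have h1 := hz.map_glide hN (-k)
    rw [glide_neg_glide] at h1
    simpa [glide_glide_neg] using glide_mem_planePreimage (hc _ h1) k
  refine ⟨key _ h.1, key _ h.2.1, Eq.trans ?_ h.2.2⟩
  rcases Int.even_or_odd k with hk | hk
  · simp only [glide_of_even _ hk, add_sub_add_right_eq_sub]
  · simp only [glide_of_odd _ hk, add_sub_add_right_eq_sub]
    rw [← abs_neg (-c'.2 - -c.2), neg_sub_neg, neg_sub]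

/-- If a component of the preimage of `D` in the plane is mapped to itself by an odd power of the
glide reflection, then `D` contains a Möbius strip. -/
theorem not_orientable_of_odd_glide {D : Set OpenMobius} (hD : IsOpen D) {z : ℝ × ℝ}
    (hz : z ∈ planePreimage D) {k₀ : ℤ} (hk₀ : Odd k₀)
    (h : glide 1 k₀ z ∈ connectedComponentIn (planePreimage D) z) : ¬ Orientable D := by
  obtain ⟨N, hchain, hN3⟩ := ((eventually_reflTransGen_cellAdj (isOpen_planePreimage hD)
    isPreconnected_connectedComponentIn (connectedComponentIn_subset _ _)
    (mem_connectedComponentIn hz) h).and (Filter.eventually_ge_atTop 3)).exists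
  have hN : N ≠ 0 := by omega
  have hNz : (N : ℤ) ≠ 0 := by exact_mod_cast hN
  have hNr : (N : ℝ) ≠ 0 := by exact_mod_cast hN
  obtain ⟨a, ha⟩ := exists_inCell N z
  obtain ⟨n, k, c, hn, hk, hstep, hper, hinj⟩ := exists_periodic_walk hNz
    (fun k c c' h => h.map_glide hN k) hk₀ (hchain _ _ ha (ha.map_glide hN k₀))
  have hlen : ∀ i, |(c (i + 1)).1 - (c i).1| ≤ 1 := fun i =>
    (le_add_of_nonneg_right (abs_nonneg _)).trans_eq (hstep i).2.2
  have hn3 : 3 ≤ n := by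
    have h1 : (c (0 + 1 * n)).1 = (c 0).1 + k * N := by
      rw [hper, mul_one]
      rfl
    have h2 : (3 : ℤ) ≤ |k * N| := by
      have hk1 : 1 ≤ |k| := Int.one_le_abs fun h0 => by simp [h0] at hk
      rw [abs_mul, Nat.abs_cast]
      have : (3 : ℤ) ≤ N := by exact_mod_cast hN3
      nlinarith
    by_contra hlt
    have h01 := abs_le.mp (hlen 0)
    have h12 := abs_le.mp (hlen 1)
    obtain rfl | rfl : n = 1 ∨ n = 2 := by omega
    · norm_num at h1 h01
      rcases le_abs.mp h2 with h3 | h3 <;> omega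
    · norm_num at h1 h01 h12
      rcases le_abs.mp h2 with h3 | h3 <;> omega
  have hc : IsUnitWalk c := by
    refine ⟨fun i => (hstep i).2.2, fun i hi => ?_⟩
    have h1 := hinj (i + 1 + 1) i 0 (by rw [hi, glide_zero])
    rw [show i + 1 + 1 - i = 2 by ring] at h1
    have := Int.le_of_dvd two_pos h1
    omega
  let f : ℝ × ℝ → ℝ × ℝ := fun w => (N : ℝ)⁻¹ • band c (n * w.1) (w.2 / 4)
  have hs : ∀ p : MobiusDom, |p.1.2 / 4| < 1 / 4 := fun p => by
    rw [abs_lt]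
    constructor <;> linarith [p.2.1, p.2.2]
  have hfE : ∀ p : MobiusDom, f p.1 ∈ planePreimage D := by
    intro p
    refine (hstep ⌊n * p.1.1⌋).2.1 _ ?_
    have := hc.abs_band_sub_le (n * p.1.1) (hs p)
    simpa only [InCell, f, Prod.smul_fst, Prod.smul_snd, smul_eq_mul, mul_inv_cancel_left₀ hNr]
  have hstrip : ∀ w ∈ planePreimage D, w.2 ∈ Set.Ioo (-1 : ℝ) 1 := by
    rintro _ ⟨p, -, rfl⟩
    exact p.2
  let g : MobiusDom → MobiusDom := fun p => ⟨f p.1, hstrip _ (hfE p)⟩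
  have hgc : Continuous g := by
    have hb : Continuous fun w : ℝ × ℝ => band c (n * w.1) (w.2 / 4) :=
      (continuous_band c).comp (by fun_prop : Continuous fun w : ℝ × ℝ => (n * w.1, w.2 / 4))
    exact ((hb.const_smul (N : ℝ)⁻¹).comp continuous_subtype_val).subtype_mk _
  have hscale : ∀ (l : ℤ) (w : ℝ × ℝ),
      (N : ℝ)⁻¹ • glide ((N : ℤ) : ℝ) l w = glide 1 l ((N : ℝ)⁻¹ • w) := by
    intro l w
    ext
    · simp only [glide, Prod.smul_fst, smul_eq_mul]
      push_cast
      field_simp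
    · simp only [glide, Prod.smul_snd, smul_eq_mul]
      ring
  have hrel : ∀ p q, mobiusRel p q → Quot.mk mobiusRel (g p) = Quot.mk mobiusRel (g q) := by
    rintro p q ⟨h1, h2⟩
    refine mobius_mk_eq_iff.mpr ⟨k, ?_⟩
    change (N : ℝ)⁻¹ • band c (n * q.1.1) (q.1.2 / 4) =
      glide 1 k ((N : ℝ)⁻¹ • band c (n * p.1.1) (p.1.2 / 4))
    rw [← hscale, h1, h2, show (n : ℝ) * (p.1.1 + 1) = n * p.1.1 + ((1 * n : ℤ) : ℝ) by
      push_cast; ring, band_add_intCast]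
    simp only [hper, mul_one]
    rw [band_glide, Int.negOnePow_odd k hk]
    congr 3
    push_cast
    ring
  refine not_orientable_of_injective (F := Quot.lift (fun p => Quot.mk mobiusRel (g p)) hrel)
    (continuous_quot_lift _ (continuous_quot_mk.comp hgc)) ?_ ?_
  · rintro ⟨p⟩ ⟨q⟩ hpq
    obtain ⟨l, hl⟩ := mobius_mk_eq_iff.mp hpq
    have hl' : (N : ℝ)⁻¹ • band c (n * q.1.1) (q.1.2 / 4) =
      glide 1 l ((N : ℝ)⁻¹ • band c (n * p.1.1) (p.1.2 / 4)) := hl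
    rw [← hscale] at hl'
    obtain ⟨m, rfl, h1, h2⟩ := hc.exists_of_band_eq_glide_band hNz hn3 hper hinj (hs q) (hs p)
      (smul_right_injective _ (inv_ne_zero hNr) hl')
    rw [negOnePow_mul_of_odd hk] at h2
    refine mobius_mk_eq_iff.mpr ⟨m, Prod.ext ?_ ?_⟩
    · have hnr : (n : ℝ) ≠ 0 := by exact_mod_cast hn.ne'
      simp only [glide]
      apply mul_left_cancel₀ hnr
      linarith
    · simp only [glide]
      linarith
  · rintro ⟨p⟩
    exact val_mem_planePreimage.mp (hfE p)

/-- Every simple closed curve contained in an orientable open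
connected subsurface `D` of the open Möbius strip disconnects `D`. -/
theorem scc_in_orientable_subsurface_disconnects
    (D : Set OpenMobius) (hDo : IsOpen D) (hDc : IsConnected D)
    (hor : Orientable D)
    (γ : Set OpenMobius) (hγ : IsSimpleClosedCurve γ) (hsub : γ ⊆ D) :
    ¬ IsPreconnected (D \ γ) := by
  rcases exists_odd_glide_or_planar hDo hDc with ⟨z, hz, k, hk, h⟩ | ⟨ψ, hψ, hinj, hopen⟩
  · exact absurd hor (not_orientable_of_odd_glide hDo hz hk h)
  · exact not_isPreconnected_diff_of_planar hψ hinj hopen hγ hsub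
end

section
/- The open Möbius strip does not contain two disjoint subsets each homeomorphic to the open Möbius strip. -/
/-! ### Continuous logarithms -/

section ContinuousLog

variable {X : Type*} [TopologicalSpace X]

lemma exists_const_of_continuous_intValued [PreconnectedSpace X] [Nonempty X] {φ : X → ℝ}
    (hφ : Continuous φ) (hint : ∀ x, ∃ n : ℤ, φ x = n) : ∃ n : ℤ, ∀ x, φ x = n := by
  choose n hn using hint
  have hcont : Continuous n := by
    rw [Int.isClosedEmbedding_coe_real.isInducing.continuous_iff]
    exact hφ.congr hn
  obtain ⟨x₀⟩ := ‹Nonempty X›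
  refine ⟨n x₀, fun x => ?_⟩
  rw [hn x, PreconnectedSpace.constant ‹_› hcont (x := x) (y := x₀)]

lemma exists_int_of_exp_eq [PreconnectedSpace X] [Nonempty X] {L₁ L₂ : X → ℂ}
    (h₁ : Continuous L₁) (h₂ : Continuous L₂) (h : ∀ x, Complex.exp (L₁ x) = Complex.exp (L₂ x)) :
    ∃ n : ℤ, ∀ x, L₁ x = L₂ x + n * (2 * Real.pi * Complex.I) := by
  have hpi : (2 * Real.pi : ℝ) ≠ 0 := by positivity
  obtain ⟨n, hn⟩ := exists_const_of_continuous_intValued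
    (φ := fun x => (L₁ x - L₂ x).im / (2 * Real.pi)) (by fun_prop) (fun x => by
      obtain ⟨n, hn⟩ := Complex.exp_eq_exp_iff_exists_int.mp (h x)
      refine ⟨n, ?_⟩
      rw [hn, div_eq_iff hpi]
      simp)
  refine ⟨n, fun x => ?_⟩
  obtain ⟨m, hm⟩ := Complex.exp_eq_exp_iff_exists_int.mp (h x)
  have hmn : (m : ℝ) = n := by
    rw [← hn x, hm, eq_div_iff hpi]
    simp
  rw [hm, Int.cast_injective hmn]

lemma exists_continuous_log [SimplyConnectedSpace X] [LocallyPathConnectedSpace X] {F : X → ℂ}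
    (hF : Continuous F) (h0 : ∀ x, F x ≠ 0) :
    ∃ L : X → ℂ, Continuous L ∧ ∀ x, Complex.exp (L x) = F x := by
  obtain ⟨x₀⟩ : Nonempty X := inferInstance
  obtain ⟨L, ⟨-, hL⟩, -⟩ := Complex.isCoveringMapOn_exp.existsUnique_continuousMap_lifts
    ⟨F, hF⟩ (Complex.exp_log (h0 x₀)) (fun x => h0 x)
  exact ⟨L, L.continuous, fun x => congr_fun hL x⟩

end ContinuousLog

/-! ### Injective plane maps and glide reflections -/

/-- A locally injective plane map cannot convert the glide reflection `z ↦ conj z + 1`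
into a translation. -/
lemma not_glide_to_translation {g : ℂ → ℂ} (hg : Continuous g)
    (hinj : ∀ z w, |z.re - w.re| < 1 → g z = g w → z = w) (k : ℂ) :
    ¬ ∀ z, g (starRingEnd ℂ z + 1) = g z + k := by
  intro hk
  set v : ℝ → ℂ := fun φ => Complex.exp (φ * Complex.I) / 4 with hv
  have hvcont : Continuous v := by fun_prop
  have hvpi : ∀ φ, v (φ + Real.pi) = -v φ := by
    intro φ
    simp [hv, add_mul, Complex.exp_add, neg_div]
  have hvconj : ∀ φ, starRingEnd ℂ (v φ) = v (-φ) := by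
    intro φ
    simp [hv, ← Complex.exp_conj, Complex.conj_ofNat]
  have hv0 : ∀ φ, v φ ≠ 0 := by
    intro φ
    simp [hv]
  have hvre : ∀ φ, |(v φ).re| ≤ 1 / 4 := by
    intro φ
    refine (Complex.abs_re_le_norm _).trans ?_
    simp [hv, Complex.norm_exp_ofReal_mul_I]
  set H : ℝ × ℝ → ℂ := fun p => g (p.1 + v p.2) - g (p.1 - v p.2) with hH
  have hHcont : Continuous H := by fun_prop
  have hH0 : ∀ p, H p ≠ 0 := by
    intro p hp
    have hvp := abs_le.mp (hvre p.2)
    have := hinj _ _ (by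
      rw [abs_lt]
      constructor <;> simp <;> linarith) (sub_eq_zero.mp hp)
    apply hv0 p.2
    linear_combination this / 2
  obtain ⟨L, hL, hexp⟩ := exists_continuous_log hHcont hH0
  obtain ⟨n, hn⟩ := exists_int_of_exp_eq
    (L₁ := fun p : ℝ × ℝ => L (p.1, p.2 + Real.pi)) (L₂ := fun p => L p + Real.pi * Complex.I)
    (by fun_prop) (by fun_prop) (by
      intro p
      simp only [hexp, Complex.exp_add, Complex.exp_pi_mul_I, hH, hvpi]
      ring_nf)
  obtain ⟨m, hm⟩ := exists_int_of_exp_eq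
    (L₁ := fun p : ℝ × ℝ => L (p.1 + 1, -p.2)) (L₂ := L) (by fun_prop) hL (by
      intro p
      simp only [hexp, hH]
      have h1 := hk (p.1 + v p.2)
      have h2 := hk (p.1 - v p.2)
      simp only [map_add, map_sub, Complex.conj_ofReal, hvconj] at h1 h2
      push_cast
      rw [show (p.1 : ℂ) + 1 + v (-p.2) = p.1 + v (-p.2) + 1 by ring,
        show (p.1 : ℂ) + 1 - v (-p.2) = p.1 - v (-p.2) + 1 by ring, h1, h2]
      ring)
  have e1 := hn (0, 0)
  have e2 := hn (1, -Real.pi)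
  have e3 := hm (0, 0)
  have e4 := hm (0, Real.pi)
  simp only [zero_add, neg_add_cancel, neg_zero] at e1 e2 e3 e4
  have h : ((2 * n + 1 : ℤ) : ℂ) * (2 * Real.pi * Complex.I) = 0 := by
    push_cast
    linear_combination e3 - e2 - e4 - e1
  have h2 : (2 * Real.pi * Complex.I : ℂ) ≠ 0 := Complex.two_pi_I_ne_zero
  have h3 : (2 * n + 1 : ℤ) = 0 := by
    exact_mod_cast (mul_eq_zero.mp h).resolve_right h2
  omega

/-! ### Curves invariant under a glide reflection intersect -/

lemma even_of_conj_shift {l : ℝ → ℂ} (hl : Continuous l) {m : ℤ}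
    (hm : l 1 = starRingEnd ℂ (l 0) + m * (2 * Real.pi * Complex.I))
    (hre : ∀ t, 0 < (Complex.exp (l t)).re) : Even m := by
  have hexp : Complex.exp (l 1) = starRingEnd ℂ (Complex.exp (l 0)) := by
    rw [hm, Complex.exp_add, Complex.exp_int_mul_two_pi_mul_I, mul_one, Complex.exp_conj]
  obtain ⟨n, hn⟩ := exists_int_of_exp_eq (L₁ := l) (L₂ := fun t => Complex.log (Complex.exp (l t)))
    hl (continuous_iff_continuousAt.mpr fun t =>
      (Complex.continuous_exp.comp hl).continuousAt.clog (Or.inl (hre t)))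
    (fun t => (Complex.exp_log (Complex.exp_ne_zero _)).symm)
  have harg : (Complex.exp (l 0)).arg ≠ Real.pi := by
    intro h
    have := (Complex.arg_eq_pi_iff.mp h).1
    linarith [hre 0]
  have h0 := hn 0
  have h1 := hn 1
  rw [hexp, Complex.log_conj _ harg, hm] at h1
  have hc := congrArg (starRingEnd ℂ) h0
  simp only [map_add, map_mul, map_intCast, Complex.conj_I, Complex.conj_ofReal, map_ofNat] at hc
  have h : ((m - 2 * n : ℤ) : ℂ) * (2 * Real.pi * Complex.I) = 0 := by
    push_cast
    linear_combination h1 - hc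
  have h3 : (m - 2 * n : ℤ) = 0 := by
    exact_mod_cast (mul_eq_zero.mp h).resolve_right Complex.two_pi_I_ne_zero
  exact ⟨n, by omega⟩

lemma exists_bound_re_sub_linear {γ : ℝ → ℂ} (hγ : Continuous γ) {k : ℝ}
    (hk : ∀ t, γ (t + 1) = starRingEnd ℂ (γ t) + k) :
    ∃ C, ∀ t, |(γ t).re - k * t| ≤ C := by
  have hp : Function.Periodic (fun t => (γ t).re - k * t) 1 := by
    intro t
    simp [hk]
    ring
  obtain ⟨C, hC⟩ := (hp.isBounded_of_continuous one_ne_zero (by fun_prop)).exists_norm_le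
  exact ⟨C, fun t => hC _ ⟨t, rfl⟩⟩

lemma exists_eq_of_conj_shift {γ₁ γ₂ : ℝ → ℂ} (h₁ : Continuous γ₁) (h₂ : Continuous γ₂)
    {k : ℝ} (hk : k ≠ 0) (hk₁ : ∀ t, γ₁ (t + 1) = starRingEnd ℂ (γ₁ t) + k)
    (hk₂ : ∀ t, γ₂ (t + 1) = starRingEnd ℂ (γ₂ t) + k) : ∃ s t, γ₁ s = γ₂ t := by
  by_contra! hne
  obtain ⟨C₁, hC₁⟩ := exists_bound_re_sub_linear h₁ hk₁
  obtain ⟨C₂, hC₂⟩ := exists_bound_re_sub_linear h₂ hk₂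
  obtain ⟨L, hL, hexp⟩ := exists_continuous_log (F := fun p : ℝ × ℝ => γ₁ p.1 - γ₂ p.2)
    (by fun_prop) (fun p => sub_ne_zero.mpr (hne _ _))
  obtain ⟨m, hm⟩ := exists_int_of_exp_eq
    (L₁ := fun p : ℝ × ℝ => L (p.1 + 1, p.2 + 1)) (L₂ := fun p => starRingEnd ℂ (L p))
    (by fun_prop) (by fun_prop) (by
      intro p
      simp only [hexp, Complex.exp_conj, hk₁, hk₂, map_sub]
      ring)
  set u := (C₁ + C₂ + 1) / k with hu
  have hku : k * u = C₁ + C₂ + 1 := by rw [hu]; field_simp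
  have hpos : Even m := by
    refine even_of_conj_shift (l := fun t => L (t + u, t)) (by fun_prop) ?_ ?_
    · have := hm (u, 0)
      simpa [add_comm] using this
    · intro t
      have a₁ := abs_le.mp (hC₁ (t + u))
      have a₂ := abs_le.mp (hC₂ t)
      rw [hexp, Complex.sub_re]
      linarith
  have hneg : Even (m + 1) := by
    refine even_of_conj_shift (l := fun t => L (t - u, t) + Real.pi * Complex.I)
      (by fun_prop) ?_ ?_
    · have := hm (-u, 0)
      simp only [zero_add, neg_add_eq_sub] at this
      simp [this]
      ring
    · intro t
      have a₁ := abs_le.mp (hC₁ (t - u))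
      have a₂ := abs_le.mp (hC₂ t)
      rw [Complex.exp_add, Complex.exp_pi_mul_I, hexp]
      simp
      linarith
  exact (Int.even_add_one.mp hneg) hpos

lemma apply_add_odd_of_conj_shift {γ : ℝ → ℂ} {k : ℤ}
    (hk : ∀ t, γ (t + 1) = starRingEnd ℂ (γ t) + k) {n : ℤ} (hn : Odd n) (t : ℝ) :
    γ (t + n) = starRingEnd ℂ (γ t) + n * k := by
  have hp : Function.Periodic (fun t => γ t - k * t) 2 := by
    intro t
    have h2 : γ (t + 2) = γ t + 2 * k := by
      rw [show t + 2 = t + 1 + 1 by ring, hk, hk]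
      simp
      ring
    simp only [h2]
    push_cast
    ring
  obtain ⟨j, rfl⟩ := hn
  have := hp.int_mul j (t + 1)
  simp only [hk] at this
  rw [show t + ((2 * j + 1 : ℤ) : ℝ) = t + 1 + j * 2 by push_cast; ring]
  push_cast at this ⊢
  linear_combination this

lemma exists_eq_of_odd_conj_shift {γ₁ γ₂ : ℝ → ℂ} (h₁ : Continuous γ₁) (h₂ : Continuous γ₂)
    {k₁ k₂ : ℤ} (odd₁ : Odd k₁) (odd₂ : Odd k₂)
    (hk₁ : ∀ t, γ₁ (t + 1) = starRingEnd ℂ (γ₁ t) + k₁)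
    (hk₂ : ∀ t, γ₂ (t + 1) = starRingEnd ℂ (γ₂ t) + k₂) : ∃ s t, γ₁ s = γ₂ t := by
  have hne : ((k₁ * k₂ : ℤ) : ℝ) ≠ 0 := by
    have h : Odd (k₁ * k₂) := odd₁.mul odd₂
    intro h0
    rw [Int.cast_eq_zero.mp h0] at h
    exact absurd h (by decide)
  obtain ⟨s, t, h⟩ := exists_eq_of_conj_shift (γ₁ := fun t => γ₁ (k₂ * t))
    (γ₂ := fun t => γ₂ (k₁ * t)) (by fun_prop) (by fun_prop) hne
    (fun t => by
      simp only [mul_add, mul_one, apply_add_odd_of_conj_shift hk₁ odd₂]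
      push_cast
      ring)
    (fun t => by
      simp only [mul_add, mul_one, apply_add_odd_of_conj_shift hk₂ odd₁]
      push_cast
      ring)
  exact ⟨_, _, h⟩

/-! ### The universal covering of the open Möbius strip -/

lemma neg_one_zpow_mul_mem_Ioo (n : ℤ) {y : ℝ} (hy : y ∈ Set.Ioo (-1 : ℝ) 1) :
    (-1 : ℝ) ^ n * y ∈ Set.Ioo (-1 : ℝ) 1 := by
  rw [Set.mem_Ioo, ← abs_lt] at hy ⊢
  simpa [abs_mul, abs_zpow] using hy

/-- The integers act on the strip by powers of the glide reflection `(x, y) ↦ (x + 1, -y)`. -/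
noncomputable instance mobiusAction : AddAction ℤ MobiusDom where
  vadd n p := ⟨(p.1.1 + n, (-1 : ℝ) ^ n * p.1.2), neg_one_zpow_mul_mem_Ioo n p.2⟩
  zero_vadd p := Subtype.ext (Prod.ext (by simp [HVAdd.hVAdd]) (by simp [HVAdd.hVAdd]))
  add_vadd m n p := by
    refine Subtype.ext (Prod.ext ?_ ?_)
    · change p.1.1 + ((m + n : ℤ) : ℝ) = p.1.1 + n + m
      push_cast
      ring
    · change (-1 : ℝ) ^ (m + n) * p.1.2 = (-1 : ℝ) ^ m * ((-1 : ℝ) ^ n * p.1.2)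
      rw [zpow_add₀ (by norm_num)]
      ring

lemma mobius_vadd_fst (n : ℤ) (p : MobiusDom) : (n +ᵥ p).1.1 = p.1.1 + n := rfl

lemma mobius_vadd_snd (n : ℤ) (p : MobiusDom) : (n +ᵥ p).1.2 = (-1 : ℝ) ^ n * p.1.2 := rfl

lemma mobiusRel_iff {p q : MobiusDom} : mobiusRel p q ↔ q = (1 : ℤ) +ᵥ p := by
  rw [Subtype.ext_iff, Prod.ext_iff, mobius_vadd_fst, mobius_vadd_snd]
  simp [mobiusRel]

lemma mk_vadd (n : ℤ) (p : MobiusDom) :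
    Quot.mk mobiusRel (n +ᵥ p) = Quot.mk mobiusRel p := by
  have step (q : MobiusDom) : Quot.mk mobiusRel ((1 : ℤ) +ᵥ q) = Quot.mk mobiusRel q :=
    (Quot.sound (mobiusRel_iff.mpr rfl)).symm
  induction n with
  | zero => rw [zero_vadd]
  | succ n ih => rw [add_comm, add_vadd, step, ih]
  | pred n ih => rw [← ih, ← step, ← add_vadd, add_sub_cancel]

lemma mk_eq_iff_mem_orbit {p q : MobiusDom} :
    Quot.mk mobiusRel p = Quot.mk mobiusRel q ↔ p ∈ AddAction.orbit ℤ q := by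
  constructor
  · intro h
    rw [← AddAction.orbitRel_apply]
    refine (AddAction.orbitRel ℤ MobiusDom).iseqv.eqvGen_iff.mp
      (Relation.EqvGen.mono (fun a b hab => ?_) _ _ (Quot.eqvGen_exact h))
    rw [mobiusRel_iff.mp hab]
    exact (AddAction.orbitRel ℤ MobiusDom).symm ⟨1, rfl⟩
  · rintro ⟨n, rfl⟩
    exact mk_vadd n q

lemma isAddQuotientCoveringMap_mk :
    IsAddQuotientCoveringMap (Quot.mk mobiusRel : MobiusDom → OpenMobius) ℤ where
  toIsQuotientMap := isQuotientMap_quot_mk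
  continuous_const_vadd n := by
    refine Continuous.subtype_mk ?_ _
    fun_prop
  apply_eq_iff_mem_orbit := mk_eq_iff_mem_orbit
  disjoint p := by
    refine ⟨{q | |q.1.1 - p.1.1| < 1 / 2},
      (isOpen_lt (by fun_prop) (by fun_prop)).mem_nhds (by simp), fun n => ?_⟩
    rintro ⟨_, ⟨q, hq, rfl⟩, hq'⟩
    simp only [Set.mem_ofPred_eq, mobius_vadd_fst, abs_lt] at hq hq'
    have h1 : (n : ℝ) < 1 := by linarith
    have h2 : (-1 : ℝ) < n := by linarith
    have h1' : n < 1 := by exact_mod_cast h1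
    have h2' : -1 < n := by exact_mod_cast h2
    omega

/-- The strip as a subset of the complex plane. -/
def mobiusToComplex (p : MobiusDom) : ℂ := ⟨p.1.1, p.1.2⟩

lemma continuous_mobiusToComplex : Continuous mobiusToComplex := by
  have : mobiusToComplex = fun p : MobiusDom => (p.1.1 : ℂ) + p.1.2 * Complex.I := by
    ext p
    exact Complex.mk_eq_add_mul_I _ _
  rw [this]
  fun_prop

lemma mobiusToComplex_injective : Function.Injective mobiusToComplex := by
  intro p q h
  exact Subtype.ext (Prod.ext (congrArg Complex.re h) (congrArg Complex.im h))

lemma mobiusToComplex_vadd_of_even {n : ℤ} (hn : Even n) (p : MobiusDom) :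
    mobiusToComplex (n +ᵥ p) = mobiusToComplex p + n := by
  apply Complex.ext <;> simp [mobiusToComplex, mobius_vadd_fst, mobius_vadd_snd, hn.neg_one_zpow]

lemma mobiusToComplex_vadd_of_odd {n : ℤ} (hn : Odd n) (p : MobiusDom) :
    mobiusToComplex (n +ᵥ p) = starRingEnd ℂ (mobiusToComplex p) + n := by
  apply Complex.ext <;> simp [mobiusToComplex, mobius_vadd_fst, mobius_vadd_snd, hn.neg_one_zpow]

/-- The universal covering of the Möbius strip, with the plane as total space. -/
noncomputable def mobiusParam (z : ℂ) : OpenMobius :=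
  Quot.mk mobiusRel ⟨(z.re, Real.tanh z.im), Real.neg_one_lt_tanh _, Real.tanh_lt_one _⟩

lemma continuous_tanh : Continuous Real.tanh := by
  rw [show Real.tanh = fun x => Real.sinh x / Real.cosh x from funext Real.tanh_eq_sinh_div_cosh]
  exact Real.continuous_sinh.div Real.continuous_cosh fun x => (Real.cosh_pos x).ne'

lemma continuous_mobiusParam : Continuous mobiusParam := by
  refine continuous_quot_mk.comp (Continuous.subtype_mk ?_ _)
  exact Complex.continuous_re.prodMk (continuous_tanh.comp Complex.continuous_im)

lemma mobiusParam_conj_add_one (z : ℂ) : mobiusParam (starRingEnd ℂ z + 1) = mobiusParam z := by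
  refine (Quot.sound ⟨?_, ?_⟩).symm <;> simp

lemma eq_of_mobiusParam_eq {z w : ℂ} (hre : |z.re - w.re| < 1)
    (h : mobiusParam z = mobiusParam w) : z = w := by
  obtain ⟨n, hn⟩ := mk_eq_iff_mem_orbit.mp h
  have h1 : w.re + n = z.re := congrArg (fun p : MobiusDom => p.1.1) hn
  have h2 : (-1 : ℝ) ^ n * Real.tanh w.im = Real.tanh z.im :=
    congrArg (fun p : MobiusDom => p.1.2) hn
  have hn0 : n = 0 := by
    rw [← h1, add_sub_cancel_left] at hre
    exact Int.abs_lt_one_iff.mp (by exact_mod_cast hre)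
  subst hn0
  simp only [Int.cast_zero, add_zero, zpow_zero, one_mul] at h1 h2
  exact Complex.ext h1.symm (Real.tanh_injective h2.symm)

/-- The core curve of an injectively mapped Möbius strip winds an odd number of times. -/
lemma exists_odd_lift_core {f : OpenMobius → OpenMobius} (hf : Continuous f)
    (hinj : Function.Injective f) :
    ∃ (γ : ℝ → MobiusDom) (k : ℤ), Continuous γ ∧ Odd k ∧
      (∀ t, Quot.mk mobiusRel (γ t) ∈ Set.range f) ∧ ∀ t, γ (t + 1) = k +ᵥ γ t := by
  have cov := isAddQuotientCoveringMap_mk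
  obtain ⟨e₀, he₀⟩ := cov.surjective (f (mobiusParam 0))
  obtain ⟨g, ⟨-, hg⟩, -⟩ := cov.isCoveringMap.existsUnique_continuousMap_lifts
    ⟨fun z => f (mobiusParam z), hf.comp continuous_mobiusParam⟩ 0 e₀ he₀
  replace hg (z : ℂ) : Quot.mk mobiusRel (g z) = f (mobiusParam z) := congr_fun hg z
  have horb (z : ℂ) : ∃ n : ℤ, n +ᵥ g z = g (starRingEnd ℂ z + 1) :=
    mk_eq_iff_mem_orbit.mp (by rw [hg, hg, mobiusParam_conj_add_one])
  obtain ⟨k, hk⟩ := exists_const_of_continuous_intValued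
    (φ := fun z : ℂ => (g (starRingEnd ℂ z + 1)).1.1 - (g z).1.1) (by fun_prop) (fun z => by
      obtain ⟨n, hn⟩ := horb z
      exact ⟨n, by rw [← hn, mobius_vadd_fst]; ring⟩)
  have hdeck (z : ℂ) : g (starRingEnd ℂ z + 1) = k +ᵥ g z := by
    obtain ⟨n, hn⟩ := horb z
    have := hk z
    rw [← hn, mobius_vadd_fst, add_sub_cancel_left, Int.cast_inj] at this
    rw [← hn, this]
  refine ⟨fun t => g t, k, by fun_prop, ?_, fun t => ⟨_, (hg t).symm⟩, fun t => ?_⟩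
  · by_contra hodd
    rw [Int.not_odd_iff_even] at hodd
    refine not_glide_to_translation (continuous_mobiusToComplex.comp g.continuous)
      (fun z w hzw h => eq_of_mobiusParam_eq hzw (hinj ?_)) k
      (fun z => by simp only [Function.comp, hdeck, mobiusToComplex_vadd_of_even hodd])
    rw [← hg, ← hg, mobiusToComplex_injective h]
  · rw [← hdeck, Complex.conj_ofReal]
    push_cast
    rfl

/-- The open Möbius strip does not contain two disjoint subsets each
homeomorphic to the open Möbius strip. -/
theorem no_two_disjoint_mobius_in_mobius :
    ¬ ∃ A B : Set OpenMobius, Disjoint A B ∧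
      Nonempty (A ≃ₜ OpenMobius) ∧ Nonempty (B ≃ₜ OpenMobius) := by
  rintro ⟨A, B, hAB, ⟨a⟩, ⟨b⟩⟩
  obtain ⟨γ₁, k₁, hc₁, odd₁, hr₁, hs₁⟩ := exists_odd_lift_core
    (continuous_subtype_val.comp a.symm.continuous)
    (Subtype.val_injective.comp a.symm.injective)
  obtain ⟨γ₂, k₂, hc₂, odd₂, hr₂, hs₂⟩ := exists_odd_lift_core
    (continuous_subtype_val.comp b.symm.continuous)
    (Subtype.val_injective.comp b.symm.injective)
  obtain ⟨s, t, h⟩ := exists_eq_of_odd_conj_shift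
    (continuous_mobiusToComplex.comp hc₁) (continuous_mobiusToComplex.comp hc₂) odd₁ odd₂
    (fun t => by simp only [Function.comp, hs₁, mobiusToComplex_vadd_of_odd odd₁])
    (fun t => by simp only [Function.comp, hs₂, mobiusToComplex_vadd_of_odd odd₂])
  have hst : γ₁ s = γ₂ t := mobiusToComplex_injective h
  obtain ⟨x, hx⟩ := hr₁ s
  obtain ⟨y, hy⟩ := hr₂ t
  refine Set.disjoint_left.mp hAB (a.symm x).2 (?_ : ((a.symm x : A) : OpenMobius) ∈ B)
  have : ((a.symm x : A) : OpenMobius) = (b.symm y : B) := by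
    change (Subtype.val ∘ a.symm) x = (Subtype.val ∘ b.symm) y
    rw [hx, hy, hst]
  rw [this]
  exact (b.symm y).2
end
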